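/- There is a function f : ℕ → ℕ, bounded above by a polynomial, such that the following holds: for every positive integer t and every integer ℓ ≥ 2·f(t), if H is a triangulated ℓ×ℓ double grid and M is a set of pairwise disjoint jumps of H with |M| ≥ f(t), then K_t is a minor of the graph H ∪ M. -/

import Mathlib

open SimpleGraph

/-- `H` is a minor of `G`: there are pairwise disjoint, connected (hence nonempty) branch
sets, one for each vertex of `H`, with an edge of `G` between the branch sets of any two
adjacent vertices of `H`. -/
def SimpleGraph.HasMinor {α : Type*} {β : Type*} (G : SimpleGraph α) (H : SimpleGraph β) : Prop :=
  ∃ B : β → Set α,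
    (∀ b, (SimpleGraph.induce (B b) G).Connected) ∧
    (Pairwise fun b b' => Disjoint (B b) (B b')) ∧
    (∀ b b', H.Adj b b' → ∃ u ∈ B b, ∃ v ∈ B b', G.Adj u v)
/-- Adjacency in the `a × b` grid. -/
def gridAdj {a b : ℕ} (p q : Fin a × Fin b) : Prop :=
  (p.1 = q.1 ∧ (p.2.val + 1 = q.2.val ∨ q.2.val + 1 = p.2.val)) ∨
  (p.2 = q.2 ∧ (p.1.val + 1 = q.1.val ∨ q.1.val + 1 = p.1.val))

/-- `p` and `q` are diagonally adjacent positions in the `a × b` grid. -/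
def diagAdj {a b : ℕ} (p q : Fin a × Fin b) : Prop :=
  (p.1.val + 1 = q.1.val ∨ q.1.val + 1 = p.1.val) ∧
  (p.2.val + 1 = q.2.val ∨ q.2.val + 1 = p.2.val)

/-- `G` is a triangulated `a × b` grid: it contains all grid edges, every edge is a grid
edge or a diagonal, and in each unit cell (with corners `p`, `q`, `r`, `s`, where
`r = p + (1,1)`, `q = p + (1,0)`, `s = p + (0,1)`) exactly one of the two diagonals
is present. -/
def IsTriangulatedGrid {a b : ℕ} (G : SimpleGraph (Fin a × Fin b)) : Prop :=
  (∀ p q, gridAdj p q → G.Adj p q) ∧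
  (∀ p q, G.Adj p q → gridAdj p q ∨ diagAdj p q) ∧
  (∀ p q r s : Fin a × Fin b,
    p.1.val + 1 = r.1.val → p.2.val + 1 = r.2.val →
    q.1.val = r.1.val → q.2.val = p.2.val →
    s.1.val = p.1.val → s.2.val = r.2.val →
    Xor' (G.Adj p r) (G.Adj q s))

/-- `p` lies on the boundary of the `ℓ × ℓ` grid. -/
def onBoundary {ℓ : ℕ} (p : Fin ℓ × Fin ℓ) : Prop :=
  p.1.val = 0 ∨ p.1.val = ℓ - 1 ∨ p.2.val = 0 ∨ p.2.val = ℓ - 1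

/-- `H` is a triangulated `ℓ × ℓ` double grid: two triangulated `ℓ × ℓ` grids, a perfect
matching between the two copies of the grid boundary, and exactly one diagonal inside each
quadrangular face created by two consecutive matching edges. -/
def IsTriangulatedDoubleGrid {ℓ : ℕ} (H : SimpleGraph (Fin 2 × Fin ℓ × Fin ℓ)) : Prop :=
  ∃ G₁ G₂ : SimpleGraph (Fin ℓ × Fin ℓ),
    IsTriangulatedGrid G₁ ∧ IsTriangulatedGrid G₂ ∧
    (∀ p q, H.Adj (0, p) (0, q) ↔ G₁.Adj p q) ∧
    (∀ p q, H.Adj (1, p) (1, q) ↔ G₂.Adj p q) ∧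
    (∀ p, H.Adj (0, p) (1, p) ↔ onBoundary p) ∧
    (∀ p q, p ≠ q → H.Adj (0, p) (1, q) → onBoundary p ∧ onBoundary q ∧ gridAdj p q) ∧
    (∀ p q, gridAdj p q → onBoundary p → onBoundary q →
      Xor' (H.Adj (0, p) (1, q)) (H.Adj (0, q) (1, p)))

/-! ### Connected vertex sets -/

section Connected

variable {V W : Type*} {G : SimpleGraph V}

lemma induce_singleton_connected (v : V) : (G.induce {v}).Connected := by
  rw [connected_iff]
  exact ⟨Preconnected.of_subsingleton, ⟨⟨v, rfl⟩⟩⟩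

lemma induce_image_connected (φ : W → V) {S : Set W} (h : ((G.comap φ).induce S).Connected) :
    (G.induce (φ '' S)).Connected :=
  h.map ⟨fun x : S => (⟨φ x, x, x.2, rfl⟩ : φ '' S), fun hab => hab⟩
    (by rintro ⟨_, w, hw, rfl⟩; exact ⟨⟨w, hw⟩, rfl⟩)

lemma induce_union_connected_of_mem {S T : Set V} (hS : (G.induce S).Connected)
    (hT : (G.induce T).Connected) {v : V} (h₁ : v ∈ S) (h₂ : v ∈ T) :
    (G.induce (S ∪ T)).Connected :=
  induce_union_connected hS.preconnected hT.preconnected ⟨v, h₁, h₂⟩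

lemma induce_union_connected_of_adj {S T : Set V} (hS : (G.induce S).Connected)
    (hT : (G.induce T).Connected) {v w : V} (h₁ : v ∈ S) (h₂ : w ∈ T) (h : G.Adj v w) :
    (G.induce (S ∪ T)).Connected := by
  have h1 := induce_union_connected_of_mem hS (induce_pair_connected_of_adj h) h₁ (by simp)
  have h2 := induce_union_connected_of_mem h1 hT (v := w) (by simp) h₂
  have h3 : S ∪ {v, w} ∪ T = S ∪ T := by
    ext x
    simp only [Set.mem_union, Set.mem_insert_iff, Set.mem_singleton_iff]
    constructor
    · rintro ((h | rfl | rfl) | h) <;> tauto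
    · tauto
  rwa [h3] at h2

end Connected

/-! ### Grid regions of the integer plane -/

/-- `Γ` contains all grid edges inside the rectangle `[x₀, x₁] × [y₀, y₁]`. -/
structure GridOn (Γ : SimpleGraph (ℤ × ℤ)) (x₀ x₁ y₀ y₁ : ℤ) : Prop where
  horiz : ∀ x y, x₀ ≤ x → x ≤ x₁ → y₀ ≤ y → y + 1 ≤ y₁ → Γ.Adj (x, y) (x, y + 1)
  vert : ∀ x y, x₀ ≤ x → x + 1 ≤ x₁ → y₀ ≤ y → y ≤ y₁ → Γ.Adj (x, y) (x + 1, y)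

/-- The horizontal segment in row `x` from column `a` to column `b`. -/
def hseg (x a b : ℤ) : Set (ℤ × ℤ) := {z | z.1 = x ∧ a ≤ z.2 ∧ z.2 ≤ b}

/-- The vertical segment in column `y` from row `a` to row `b`. -/
def vseg (y a b : ℤ) : Set (ℤ × ℤ) := {z | z.2 = y ∧ a ≤ z.1 ∧ z.1 ≤ b}

@[simp] lemma mem_hseg {x a b : ℤ} {z : ℤ × ℤ} :
    z ∈ hseg x a b ↔ z.1 = x ∧ a ≤ z.2 ∧ z.2 ≤ b := Iff.rfl

@[simp] lemma mem_vseg {y a b : ℤ} {z : ℤ × ℤ} :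
    z ∈ vseg y a b ↔ z.2 = y ∧ a ≤ z.1 ∧ z.1 ≤ b := Iff.rfl

namespace GridOn

variable {Γ : SimpleGraph (ℤ × ℤ)} {x₀ x₁ y₀ y₁ : ℤ}

lemma mono (h : GridOn Γ x₀ x₁ y₀ y₁) {x₀' x₁' y₀' y₁' : ℤ} (h1 : x₀ ≤ x₀') (h2 : x₁' ≤ x₁)
    (h3 : y₀ ≤ y₀') (h4 : y₁' ≤ y₁) : GridOn Γ x₀' x₁' y₀' y₁' :=
  ⟨fun _ _ _ _ _ _ => h.horiz _ _ (by omega) (by omega) (by omega) (by omega),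
    fun _ _ _ _ _ _ => h.vert _ _ (by omega) (by omega) (by omega) (by omega)⟩

lemma hseg_connected (h : GridOn Γ x₀ x₁ y₀ y₁) {x a b : ℤ} (hx : x₀ ≤ x) (hx' : x ≤ x₁)
    (ha : y₀ ≤ a) (hab : a ≤ b) (hb : b ≤ y₁) : (Γ.induce (hseg x a b)).Connected := by
  induction b, hab using Int.leInduction with
  | base =>
    have : hseg x a a = {(x, a)} := by
      ext ⟨u, v⟩
      simp only [mem_hseg, Set.mem_singleton_iff, Prod.mk.injEq]
      omega
    rw [this]
    exact induce_singleton_connected _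
  | succ b hab ih =>
    have := induce_union_connected_of_adj (ih (by omega)) (induce_singleton_connected (x, (b + 1)))
      (v := (x, b)) (w := (x, (b + 1))) (by simp [hab]) rfl
      (h.horiz x b (by omega) (by omega) (by omega) (by omega))
    refine (congrArg (fun S => (Γ.induce S).Connected) ?_).mp this
    ext ⟨u, v⟩
    simp only [mem_hseg, Set.mem_union, Set.mem_singleton_iff, Prod.mk.injEq]
    omega

lemma vseg_connected (h : GridOn Γ x₀ x₁ y₀ y₁) {y a b : ℤ} (hy : y₀ ≤ y) (hy' : y ≤ y₁)
    (ha : x₀ ≤ a) (hab : a ≤ b) (hb : b ≤ x₁) : (Γ.induce (vseg y a b)).Connected := by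
  induction b, hab using Int.leInduction with
  | base =>
    have : vseg y a a = {(a, y)} := by
      ext ⟨u, v⟩
      simp only [mem_vseg, Set.mem_singleton_iff, Prod.mk.injEq]
      omega
    rw [this]
    exact induce_singleton_connected _
  | succ b hab ih =>
    have := induce_union_connected_of_adj (ih (by omega)) (induce_singleton_connected ((b + 1), y))
      (v := (b, y)) (w := ((b + 1), y)) (by simp [hab]) rfl
      (h.vert b y (by omega) (by omega) (by omega) (by omega))
    refine (congrArg (fun S => (Γ.induce S).Connected) ?_).mp this
    ext ⟨u, v⟩
    simp only [mem_vseg, Set.mem_union, Set.mem_singleton_iff, Prod.mk.injEq]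
    omega

end GridOn

/-- A bundle of `t` disjoint connected sets in the columns `[y₀, e]`, the `i`-th of which ends
in column `e` at height `σ i` above the bottom row `x₀`. -/
structure Bundle {t : ℕ} (Γ : SimpleGraph (ℤ × ℤ)) (x₀ x₁ y₀ e : ℤ) (σ : Equiv.Perm (Fin t))
    (B : Fin t → Set (ℤ × ℤ)) : Prop where
  conn : ∀ i, (Γ.induce (B i)).Connected
  disj : ∀ i j, i ≠ j → ∀ z, z ∈ B i → z ∉ B j
  mem : ∀ i, ∀ z ∈ B i, x₀ ≤ z.1 ∧ z.1 ≤ x₁ ∧ y₀ ≤ z.2 ∧ z.2 ≤ e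
  tip : ∀ i, (x₀ + (σ i).val, e) ∈ B i

/-- The path climbing from height `q` in column `a` to row `u` in column `c - 1`. -/
def climb (x₀ a c q u : ℤ) : Set (ℤ × ℤ) :=
  (hseg (x₀ + q) a (c - 1 - q) ∪ vseg (c - 1 - q) (x₀ + q) u) ∪ hseg u (c - 1 - q) (c - 1)

/-- The path descending from row `u` in column `c + 1` to height `q` in column `b`. -/
def descend (x₀ c b q u : ℤ) : Set (ℤ × ℤ) :=
  (hseg u (c + 1) (c + 1 + q) ∪ vseg (c + 1 + q) (x₀ + q) u) ∪ hseg (x₀ + q) (c + 1 + q) b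

lemma climb_connected {Γ : SimpleGraph (ℤ × ℤ)} {x₀ x₁ y₀ y₁ : ℤ} (hG : GridOn Γ x₀ x₁ y₀ y₁)
    {a c q u : ℤ} (hq : 0 ≤ q) (hu : x₀ + q ≤ u) (hu' : u ≤ x₁) (ha : y₀ ≤ a) (hac : a ≤ c - 1 - q)
    (hc : c - 1 ≤ y₁) : (Γ.induce (climb x₀ a c q u)).Connected := by
  refine induce_union_connected_of_mem (v := (u, c - 1 - q))
    (induce_union_connected_of_mem (v := (x₀ + q, c - 1 - q))
      (hG.hseg_connected (by omega) (by omega) ha hac (by omega))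
      (hG.vseg_connected (by omega) (by omega) (by omega) hu hu') ?_ ?_)
    (hG.hseg_connected (by omega) (by omega) (by omega) (by omega) (by omega)) ?_ ?_ <;>
  simp only [Set.mem_union, mem_hseg, mem_vseg, true_and] <;> omega

lemma descend_connected {Γ : SimpleGraph (ℤ × ℤ)} {x₀ x₁ y₀ y₁ : ℤ} (hG : GridOn Γ x₀ x₁ y₀ y₁)
    {c b q u : ℤ} (hq : 0 ≤ q) (hu : x₀ + q ≤ u) (hu' : u ≤ x₁) (hc : y₀ ≤ c + 1)
    (hcb : c + 1 + q ≤ b) (hb : b ≤ y₁) : (Γ.induce (descend x₀ c b q u)).Connected := by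
  refine induce_union_connected_of_mem (v := (x₀ + q, c + 1 + q))
    (induce_union_connected_of_mem (v := (u, c + 1 + q))
      (hG.hseg_connected (by omega) (by omega) hc (by omega) (by omega))
      (hG.vseg_connected (by omega) (by omega) (by omega) hu hu') ?_ ?_)
    (hG.hseg_connected (by omega) (by omega) (by omega) (by omega) (by omega)) ?_ ?_ <;>
  simp only [Set.mem_union, mem_hseg, mem_vseg, true_and] <;> omega

lemma Bundle.extend {t : ℕ} {Γ : SimpleGraph (ℤ × ℤ)} {x₀ x₁ y₀ y₁ e : ℤ}
    {σ : Equiv.Perm (Fin t)} {B : Fin t → Set (ℤ × ℤ)} (h : Bundle Γ x₀ x₁ y₀ e σ B)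
    (hG : GridOn Γ x₀ x₁ y₀ y₁) (hy : y₀ ≤ e) {c d : ℤ} (hc : e + t + 1 ≤ c) (hcd : c ≤ d)
    (hd : d + t + 1 ≤ y₁) {u v : Fin t → ℤ} (hu : StrictMono u) (hv : StrictMono v)
    (hu₀ : ∀ q, x₀ + q.val ≤ u q) (hu₁ : ∀ q, u q ≤ x₁)
    (hv₀ : ∀ q, x₀ + q.val ≤ v q) (hv₁ : ∀ q, v q ≤ x₁)
    {π : Equiv.Perm (Fin t)} {S : Fin t → Set (ℤ × ℤ)}
    (hS : ∀ q, (Γ.induce (S q)).Connected) (hSd : ∀ q r, q ≠ r → ∀ z, z ∈ S q → z ∉ S r)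
    (hSm : ∀ q, ∀ z ∈ S q, x₀ ≤ z.1 ∧ z.1 ≤ x₁ ∧ c ≤ z.2 ∧ z.2 ≤ d)
    (hSu : ∀ q, (u q, c) ∈ S q) (hSv : ∀ q, (v (π q), d) ∈ S q) :
    ∃ B' : Fin t → Set (ℤ × ℤ), Bundle Γ x₀ x₁ y₀ (d + t + 1) (σ.trans π) B' ∧
      (∀ i, B i ⊆ B' i) ∧ ∀ i, S (σ i) ⊆ B' i := by
  have climb_disj : ∀ q r, q ≠ r → ∀ z, z ∈ climb x₀ (e + 1) c q.val (u q) →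
      z ∉ climb x₀ (e + 1) c r.val (u r) := by
    intro q r hqr z
    have := hu₀ q
    have := hu₀ r
    simp only [climb, Set.mem_union, mem_hseg, mem_vseg]
    rcases lt_or_gt_of_ne hqr with hlt | hlt <;>
    · have := hu hlt
      simp only [Fin.lt_def] at hlt
      omega
  have descend_disj : ∀ q r, q ≠ r → ∀ z, z ∈ descend x₀ d (d + t + 1) q.val (v q) →
      z ∉ descend x₀ d (d + t + 1) r.val (v r) := by
    intro q r hqr z
    have := hv₀ q
    have := hv₀ r
    simp only [descend, Set.mem_union, mem_hseg, mem_vseg]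
    rcases lt_or_gt_of_ne hqr with hlt | hlt <;>
    · have := hv hlt
      simp only [Fin.lt_def] at hlt
      omega
  have climb_mem : ∀ q, ∀ z ∈ climb x₀ (e + 1) c q.val (u q),
      x₀ ≤ z.1 ∧ z.1 ≤ x₁ ∧ e + 1 ≤ z.2 ∧ z.2 ≤ c - 1 := by
    intro q z
    have := hu₀ q
    have := hu₁ q
    simp only [climb, Set.mem_union, mem_hseg, mem_vseg]
    omega
  have descend_mem : ∀ q, ∀ z ∈ descend x₀ d (d + t + 1) q.val (v q),
      x₀ ≤ z.1 ∧ z.1 ≤ x₁ ∧ d + 1 ≤ z.2 ∧ z.2 ≤ d + t + 1 := by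
    intro q z
    have := hv₀ q
    have := hv₁ q
    simp only [descend, Set.mem_union, mem_hseg, mem_vseg]
    omega
  refine ⟨fun i => ((B i ∪ climb x₀ (e + 1) c (σ i).val (u (σ i))) ∪ S (σ i)) ∪
    descend x₀ d (d + t + 1) (π (σ i)).val (v (π (σ i))), ⟨?_, ?_, ?_, ?_⟩, ?_, ?_⟩
  · intro i
    have := hu₀ (σ i)
    have := hu₁ (σ i)
    have := hv₀ (π (σ i))
    have := hv₁ (π (σ i))
    refine induce_union_connected_of_adj (v := (v (π (σ i)), d)) (w := (v (π (σ i)), d + 1))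
      (induce_union_connected_of_adj (v := (u (σ i), c - 1)) (w := (u (σ i), c))
        (induce_union_connected_of_adj (v := (x₀ + (σ i).val, e)) (w := (x₀ + (σ i).val, e + 1))
          (h.conn i) (climb_connected hG (by omega) (by omega) (by omega) (by omega) (by omega)
            (by omega))
          (h.tip i) ?_ (hG.horiz _ _ (by omega) (by omega) (by omega) (by omega)))
        (hS _) ?_ (hSu _) ?_)
      (descend_connected hG (by omega) (by omega) (by omega) (by omega) (by omega) (by omega)) ?_ ?_
      (hG.horiz _ _ (by omega) (by omega) (by omega) (by omega))
    · simp only [climb, Set.mem_union, mem_hseg, mem_vseg, true_and]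
      omega
    · simp only [climb, Set.mem_union, mem_hseg, mem_vseg, true_and]
      omega
    · simpa using hG.horiz (u (σ i)) (c - 1) (by omega) (by omega) (by omega) (by omega)
    · exact Or.inr (hSv _)
    · simp only [descend, Set.mem_union, mem_hseg, mem_vseg, true_and]
      omega
  · intro i j hij z hi hj
    have hσ : σ i ≠ σ j := fun h => hij (σ.injective h)
    have hπ : π (σ i) ≠ π (σ j) := fun h => hσ (π.injective h)
    have := h.mem i z
    have := h.mem j z
    have := hSm (σ i) z
    have := hSm (σ j) z
    have := climb_mem (σ i) z
    have := climb_mem (σ j) z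
    have := descend_mem (π (σ i)) z
    have := descend_mem (π (σ j)) z
    have := h.disj i j hij z
    have := hSd _ _ hσ z
    have := climb_disj _ _ hσ z
    have := descend_disj _ _ hπ z
    rcases hi with ((hi | hi) | hi) | hi <;> rcases hj with ((hj | hj) | hj) | hj <;>
      simp only [hi, hj, true_imp_iff, not_true_eq_false] at * <;> omega
  · intro i z hz
    have := h.mem i z
    have := hSm (σ i) z
    have := climb_mem (σ i) z
    have := descend_mem (π (σ i)) z
    rcases hz with ((hz | hz) | hz) | hz <;> simp only [hz, true_imp_iff] at * <;> omega
  · intro i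
    refine Or.inr ?_
    have := hv₀ (π (σ i))
    simp only [descend, Set.mem_union, mem_hseg, mem_vseg, Equiv.trans_apply, true_and]
    omega
  · exact fun i z hz => Or.inl (Or.inl (Or.inl hz))
  · exact fun i z hz => Or.inl (Or.inr hz)

lemma bundle_start {Γ : SimpleGraph (ℤ × ℤ)} {x₀ x₁ y₀ : ℤ} {t : ℕ} (h : x₀ + t ≤ x₁ + 1) :
    Bundle Γ x₀ x₁ y₀ y₀ (1 : Equiv.Perm (Fin t)) fun i => {(x₀ + i.val, y₀)} where
  conn i := induce_singleton_connected _
  disj i j hij z hi hj := by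
    rw [Set.mem_singleton_iff] at hi hj
    simp only [hi, Prod.mk.injEq] at hj
    omega
  mem i z hz := by
    rw [Set.mem_singleton_iff] at hz
    subst hz
    simp only
    omega
  tip i := by simp

/-! ### Charts and linkages -/

/-- The lattice rectangle `[x₀, x₁] × [y₀, y₁]`. -/
def rect (x₀ x₁ y₀ y₁ : ℤ) : Set (ℤ × ℤ) := {z | x₀ ≤ z.1 ∧ z.1 ≤ x₁ ∧ y₀ ≤ z.2 ∧ z.2 ≤ y₁}

@[simp] lemma mem_rect {x₀ x₁ y₀ y₁ : ℤ} {z : ℤ × ℤ} :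
    z ∈ rect x₀ x₁ y₀ y₁ ↔ x₀ ≤ z.1 ∧ z.1 ≤ x₁ ∧ y₀ ≤ z.2 ∧ z.2 ≤ y₁ := Iff.rfl

/-- The sites `p k`, `k ∈ K`, are pairwise at distance at least `w` in the first coordinate,
or pairwise at distance at least `w` in the second coordinate. -/
def Spread {ι : Type*} (w : ℤ) (p : ι → ℤ × ℤ) (K : Finset ι) : Prop :=
  (∀ k ∈ K, ∀ l ∈ K, k ≠ l → w ≤ |(p k).1 - (p l).1|) ∨
    ∀ k ∈ K, ∀ l ∈ K, k ≠ l → w ≤ |(p k).2 - (p l).2|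

/-- For every colouring with `t` colours of the vertices `s k`, `k ∈ K`, there are `t` disjoint
connected subsets of `U`, the `i`-th of which contains all vertices of colour `i`. -/
def Links {V ι : Type*} (G : SimpleGraph V) (U : Set V) (s : ι → V) (K : Finset ι) (t : ℕ) : Prop :=
  ∀ c : ι → Fin t, ∃ L : Fin t → Set V, (∀ i, (G.induce (L i)).Connected) ∧
    (Pairwise fun i j => Disjoint (L i) (L j)) ∧ (∀ i, L i ⊆ U) ∧ ∀ k ∈ K, s k ∈ L (c k)

/-- `φ` embeds the grid on the rectangle `[x₀, x₁] × [y₀, y₁]` into `G`. -/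
structure Chart {V : Type*} (G : SimpleGraph V) (φ : ℤ × ℤ → V) (x₀ x₁ y₀ y₁ : ℤ) : Prop where
  inj : Set.InjOn φ (rect x₀ x₁ y₀ y₁)
  grid : GridOn (G.comap φ) x₀ x₁ y₀ y₁

section Links

variable {V ι : Type*} {G : SimpleGraph V} {x₀ x₁ y₀ y₁ : ℤ} {φ : ℤ × ℤ → V} {t : ℕ}

lemma GridOn.exists_bundle {Γ : SimpleGraph (ℤ × ℤ)} (hG : GridOn Γ x₀ x₁ y₀ y₁)
    (hx : x₀ + t ≤ x₁ + 1) (hy : y₀ ≤ y₁) (K : Finset ι) (p : ι → ℤ × ℤ) (c : ι → Fin t)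
    (hp : ∀ k ∈ K, p k ∈ rect (x₀ + (t + 1)) (x₁ - (t + 1)) (y₀ + (t + 1)) (y₁ - (t + 1)))
    (hsep : ∀ k ∈ K, ∀ l ∈ K, k ≠ l → 2 * (t : ℤ) + 2 ≤ |(p k).2 - (p l).2|) :
    ∃ e B, Bundle Γ x₀ x₁ y₀ e (1 : Equiv.Perm (Fin t)) B ∧
      (e = y₀ ∨ ∃ k ∈ K, e = (p k).2 + t + 1) ∧ ∀ k ∈ K, p k ∈ B (c k) := by
  classical
  induction K using Finset.induction_on_max_value (fun k => (p k).2) with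
  | empty => exact ⟨y₀, _, bundle_start hx, Or.inl rfl, by simp⟩
  | insert a K haK hmax ih =>
    obtain ⟨e, B, hB, he, hpB⟩ := ih (fun k hk => hp k (Finset.mem_insert_of_mem hk))
      fun k hk l hl => hsep k (Finset.mem_insert_of_mem hk) l (Finset.mem_insert_of_mem hl)
    have ha := hp a (Finset.mem_insert_self a K)
    rw [mem_rect] at ha
    have he' : y₀ ≤ e ∧ e + t + 1 ≤ (p a).2 := by
      rcases he with rfl | ⟨k, hk, rfl⟩
      · omega
      · have h1 := hsep a (Finset.mem_insert_self a K) k (Finset.mem_insert_of_mem hk)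
          (fun h => haK (h ▸ hk))
        have h2 := hmax k hk
        have h3 := hp k (Finset.mem_insert_of_mem hk)
        rw [mem_rect] at h3
        rw [abs_of_nonneg (by omega)] at h1
        omega
    have hca := (c a).isLt
    have hu : StrictMono fun q : Fin t => (p a).1 - (c a).val + q.val := by
      intro q r hqr
      simp only [Fin.lt_def] at hqr
      simp only
      omega
    obtain ⟨B', hB', hsub, hS⟩ := hB.extend hG he'.1 he'.2 le_rfl (by omega) hu hu
      (fun q => by have := q.isLt; omega) (fun q => by have := q.isLt; omega)
      (fun q => by have := q.isLt; omega) (fun q => by have := q.isLt; omega)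
      (π := 1) (S := fun q => {((p a).1 - (c a).val + q.val, (p a).2)})
      (fun q => induce_singleton_connected _)
      (by
        intro q r hqr z hz hz'
        rw [Set.mem_singleton_iff] at hz hz'
        simp only [hz, Prod.mk.injEq] at hz'
        exact hqr (Fin.ext (by omega)))
      (by
        intro q z hz
        rw [Set.mem_singleton_iff] at hz
        have := q.isLt
        simp only [hz]
        omega)
      (fun q => rfl) (fun q => rfl)
    refine ⟨_, B', hB', Or.inr ⟨a, Finset.mem_insert_self a K, rfl⟩, ?_⟩
    intro k hk
    rcases Finset.mem_insert.1 hk with rfl | hk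
    · refine hS (c k) ?_
      simp
    · exact hsub _ (hpB k hk)

lemma GridOn.swap {Γ : SimpleGraph (ℤ × ℤ)} (h : GridOn Γ x₀ x₁ y₀ y₁) :
    GridOn (Γ.comap Prod.swap) y₀ y₁ x₀ x₁ :=
  ⟨fun _ _ h1 h2 h3 h4 => h.vert _ _ h3 h4 h1 h2, fun _ _ h1 h2 h3 h4 => h.horiz _ _ h3 h4 h1 h2⟩

lemma Chart.mono (h : Chart G φ x₀ x₁ y₀ y₁) {x₀' x₁' y₀' y₁' : ℤ} (h1 : x₀ ≤ x₀') (h2 : x₁' ≤ x₁)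
    (h3 : y₀ ≤ y₀') (h4 : y₁' ≤ y₁) : Chart G φ x₀' x₁' y₀' y₁' :=
  ⟨h.inj.mono fun z hz => by rw [mem_rect] at *; omega, h.grid.mono h1 h2 h3 h4⟩

lemma Chart.swap (h : Chart G φ x₀ x₁ y₀ y₁) : Chart G (φ ∘ Prod.swap) y₀ y₁ x₀ x₁ :=
  ⟨h.inj.comp Prod.swap_injective.injOn fun z hz => by
    simp only [mem_rect, Prod.fst_swap, Prod.snd_swap] at *; omega, h.grid.swap⟩

lemma Chart.links_of_snd (h : Chart G φ x₀ x₁ y₀ y₁) (hx : x₀ + t ≤ x₁ + 1) (hy : y₀ ≤ y₁)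
    {K : Finset ι} {p : ι → ℤ × ℤ}
    (hp : ∀ k ∈ K, p k ∈ rect (x₀ + (t + 1)) (x₁ - (t + 1)) (y₀ + (t + 1)) (y₁ - (t + 1)))
    (hsep : ∀ k ∈ K, ∀ l ∈ K, k ≠ l → 2 * (t : ℤ) + 2 ≤ |(p k).2 - (p l).2|) :
    Links G (φ '' rect x₀ x₁ y₀ y₁) (φ ∘ p) K t := by
  intro c
  obtain ⟨e, B, hB, he, hc⟩ := h.grid.exists_bundle hx hy K p c hp hsep
  have he' : e ≤ y₁ := by
    rcases he with rfl | ⟨k, hk, rfl⟩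
    · exact hy
    · have := hp k hk
      rw [mem_rect] at this
      omega
  have hm : ∀ i, ∀ z ∈ B i, z ∈ rect x₀ x₁ y₀ y₁ := fun i z hz => by
    have := hB.mem i z hz
    rw [mem_rect]
    omega
  refine ⟨fun i => φ '' B i, fun i => induce_image_connected φ (hB.conn i), ?_,
    fun i => Set.image_mono (hm i), fun k hk => ⟨_, hc k hk, rfl⟩⟩
  intro i j hij
  rw [Set.disjoint_left]
  rintro _ ⟨z, hz, rfl⟩ ⟨z', hz', hzz⟩
  rw [h.inj (hm _ _ hz') (hm _ _ hz) hzz] at hz'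
  exact hB.disj i j hij z hz hz'

lemma Chart.links (h : Chart G φ x₀ x₁ y₀ y₁) (hx : x₀ + t ≤ x₁) (hy : y₀ + t ≤ y₁)
    {K : Finset ι} {p : ι → ℤ × ℤ}
    (hp : ∀ k ∈ K, p k ∈ rect (x₀ + (t + 1)) (x₁ - (t + 1)) (y₀ + (t + 1)) (y₁ - (t + 1)))
    (hsep : Spread (2 * (t : ℤ) + 2) p K) :
    Links G (φ '' rect x₀ x₁ y₀ y₁) (φ ∘ p) K t := by
  rcases hsep with hsep | hsep
  · have := h.swap.links_of_snd (t := t) (by omega) (by omega) (K := K) (p := Prod.swap ∘ p)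
      (fun k hk => by
        have := hp k hk
        simp only [mem_rect, Function.comp, Prod.fst_swap, Prod.snd_swap] at *
        omega) (fun k hk l hl hkl => by simpa using hsep k hk l hl hkl)
    intro c
    obtain ⟨L, h1, h2, h3, h4⟩ := this c
    refine ⟨L, h1, h2, fun i => (h3 i).trans ?_, fun k hk => by simpa using h4 k hk⟩
    rintro _ ⟨z, hz, rfl⟩
    refine ⟨z.swap, ?_, rfl⟩
    simp only [mem_rect, Prod.fst_swap, Prod.snd_swap] at *
    omega
  · exact h.links_of_snd (by omega) (by omega) hp hsep

/-- If `K` has at least `t ^ 2` elements, it can be coloured so that every pair of colours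
appears. -/
lemma exists_colouring {K : Finset ι} (ht : 0 < t) (hK : t ^ 2 ≤ K.card) :
    ∃ c : ι → Fin t × Fin t, ∀ x, ∃ k ∈ K, c k = x := by
  obtain ⟨g⟩ := Function.Embedding.nonempty_of_card_le (α := Fin t × Fin t) (β := K)
    (by simpa [sq] using hK)
  have : Nonempty (Fin t × Fin t) := ⟨⟨⟨0, ht⟩, ⟨0, ht⟩⟩⟩
  exact ⟨Function.invFun fun x => (g x : ι), fun x => ⟨g x, (g x).2,
    Function.leftInverse_invFun (Subtype.val_injective.comp g.injective) x⟩⟩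

lemma hasMinor_of_links_sum {s r : ι → V} {K : Finset ι} (ht : 0 < t) (hK : t ^ 2 ≤ K.card)
    (hadj : ∀ k ∈ K, G.Adj (s k) (r k)) {U : Set V}
    (h : Links G U (Sum.elim s r) (K.disjSum K) t) : G.HasMinor (⊤ : SimpleGraph (Fin t)) := by
  obtain ⟨c, hc⟩ := exists_colouring ht hK
  obtain ⟨L, h1, h2, -, h4⟩ := h (Sum.elim (fun k => (c k).1) fun k => (c k).2)
  refine ⟨L, h1, h2, fun i j _ => ?_⟩
  obtain ⟨k, hk, hck⟩ := hc (i, j)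
  have h5 := h4 (Sum.inl k) (by simpa using hk)
  have h6 := h4 (Sum.inr k) (by simpa using hk)
  simp only [Sum.elim_inl, Sum.elim_inr, hck] at h5 h6
  exact ⟨_, h5, _, h6, hadj k hk⟩

lemma hasMinor_of_links {s r : ι → V} {K : Finset ι} (ht : 0 < t) (hK : t ^ 2 ≤ K.card)
    (hadj : ∀ k ∈ K, G.Adj (s k) (r k)) {U U' : Set V} (hU : Disjoint U U')
    (hs : Links G U s K t) (hr : Links G U' r K t) : G.HasMinor (⊤ : SimpleGraph (Fin t)) := by
  obtain ⟨c, hc⟩ := exists_colouring ht hK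
  obtain ⟨L, h1, h2, h3, h4⟩ := hs fun k => (c k).1
  obtain ⟨L', h1', h2', h3', h4'⟩ := hr fun k => (c k).2
  have key : ∀ i j, ∃ u ∈ L i, ∃ v ∈ L' j, G.Adj u v := by
    intro i j
    obtain ⟨k, hk, hck⟩ := hc (i, j)
    have h5 := h4 k hk
    have h6 := h4' k hk
    simp only [hck] at h5 h6
    exact ⟨_, h5, _, h6, hadj k hk⟩
  refine ⟨fun i => L i ∪ L' i, fun i => ?_, fun i j hij => ?_, fun i j _ => ?_⟩
  · obtain ⟨u, hu, v, hv, huv⟩ := key i i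
    exact induce_union_connected_of_adj (h1 i) (h1' i) hu hv huv
  · simp only [Set.disjoint_union_left, Set.disjoint_union_right]
    exact ⟨⟨h2 hij, (hU.mono (h3 j) (h3' i)).symm⟩, hU.mono (h3 i) (h3' j), h2' hij⟩
  · obtain ⟨u, hu, v, hv, huv⟩ := key i j
    exact ⟨u, Or.inl hu, v, Or.inr hv, huv⟩

end Links

/-! ### Extracting spread-out sites -/

section Spread

variable {ι : Type*}

lemma exists_subset_injOn_card {α : Type*} [DecidableEq α] (f : ι → α) (F : Finset ι) :
    ∃ S ⊆ F, Set.InjOn f S ∧ S.card = (F.image f).card := by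
  classical
  obtain ⟨S, hS, hinj, him⟩ := Finset.exists_subset_injOn_image_eq_of_surjOn (f := f) F (F.image f)
    (by rw [Finset.coe_image]; exact Set.surjOn_image f F)
  exact ⟨S, hS, hinj, by rw [← him, Finset.card_image_of_injOn hinj]⟩

lemma le_abs_sub_of_emod_eq {w a b : ℤ} (h : a % w = b % w) (hab : a ≠ b) : w ≤ |a - b| := by
  have h1 : w ∣ a - b := Int.ModEq.dvd (Int.ModEq.symm h)
  exact Int.le_of_dvd (abs_pos.2 (sub_ne_zero.2 hab)) ((dvd_abs _ _).2 h1)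

lemma exists_spread {p : ι → ℤ × ℤ} {S : Finset ι} (hp : Set.InjOn p S) {w n : ℕ} (hw : 0 < w)
    (hS : w ^ 2 * n ^ 2 ≤ S.card) : ∃ S' ⊆ S, n ≤ S'.card ∧ Spread w p S' := by
  classical
  have hw' : (0 : ℤ) < w := by exact_mod_cast hw
  obtain ⟨r, -, hr⟩ := Finset.exists_le_card_fiber_of_mul_le_card_of_maps_to (s := S) (n := n ^ 2)
    (t := Finset.Ico (0 : ℤ) w ×ˢ Finset.Ico (0 : ℤ) w)
    (f := fun k => ((p k).1 % (w : ℤ), (p k).2 % (w : ℤ)))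
    (fun k _ => by
      simp only [Finset.mem_product, Finset.mem_Ico]
      exact ⟨⟨Int.emod_nonneg _ hw'.ne', Int.emod_lt_of_pos _ hw'⟩,
        Int.emod_nonneg _ hw'.ne', Int.emod_lt_of_pos _ hw'⟩)
    ⟨(0, 0), by simp [hw]⟩ (by simpa [← sq] using hS)
  set F := S.filter fun k => ((p k).1 % (w : ℤ), (p k).2 % (w : ℤ)) = r with hF
  have hFS : F ⊆ S := Finset.filter_subset _ _
  have hmod : ∀ k ∈ F, ∀ l ∈ F, (p k).1 % (w : ℤ) = (p l).1 % w ∧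
      (p k).2 % (w : ℤ) = (p l).2 % w := by
    intro k hk l hl
    have := (Finset.mem_filter.1 hk).2.trans (Finset.mem_filter.1 hl).2.symm
    simpa using this
  by_cases hcard : n ≤ (F.image fun k => (p k).1).card
  · obtain ⟨S', hS', hinj, hc⟩ := exists_subset_injOn_card (fun k => (p k).1) F
    exact ⟨S', hS'.trans hFS, hc ▸ hcard, Or.inl fun k hk l hl hkl =>
      le_abs_sub_of_emod_eq (hmod k (hS' hk) l (hS' hl)).1 fun h => hkl (hinj hk hl h)⟩
  · have hn : 0 < n ^ 2 := by
      have : 0 < n := by omega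
      positivity
    obtain ⟨k₀, hk₀⟩ := Finset.card_pos.1 (hn.trans_le hr)
    obtain ⟨x, -, hx⟩ := Finset.exists_le_card_fiber_of_mul_le_card_of_maps_to (s := F) (n := n)
      (t := F.image fun k => (p k).1) (f := fun k => (p k).1)
      (fun k hk => Finset.mem_image_of_mem _ hk) ⟨_, Finset.mem_image_of_mem _ hk₀⟩
      (le_trans (by rw [sq]; exact Nat.mul_le_mul_right _ (by omega)) hr)
    refine ⟨_, (Finset.filter_subset _ _).trans hFS, hx, Or.inr fun k hk l hl hkl => ?_⟩
    rw [Finset.mem_filter] at hk hl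
    exact le_abs_sub_of_emod_eq (hmod k hk.1 l hl.1).2 fun h =>
      hkl (hp (hFS hk.1) (hFS hl.1) (Prod.ext (hk.2.trans hl.2.symm) h))

lemma Spread.mono {w : ℤ} {p : ι → ℤ × ℤ} {K K' : Finset ι} (h : Spread w p K) (hK : K' ⊆ K) :
    Spread w p K' :=
  h.imp (fun h k hk l hl => h k (hK hk) l (hK hl)) fun h k hk l hl => h k (hK hk) l (hK hl)

end Spread

/-- The number of jumps between two disjoint charts that force a `K_t` minor. -/
def crossBound (t : ℕ) : ℕ := (2 * t + 2) ^ 2 * ((2 * t + 2) ^ 2 * (t ^ 2) ^ 2) ^ 2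

lemma hasMinor_of_cross {V ι : Type*} {G : SimpleGraph V} {t : ℕ} (ht : 0 < t)
    {φ φ' : ℤ × ℤ → V} {x₀ x₁ y₀ y₁ x₀' x₁' y₀' y₁' : ℤ}
    (h : Chart G φ x₀ x₁ y₀ y₁) (h' : Chart G φ' x₀' x₁' y₀' y₁')
    (hdisj : Disjoint (φ '' rect x₀ x₁ y₀ y₁) (φ' '' rect x₀' x₁' y₀' y₁'))
    {K : Finset ι} (hK : crossBound t ≤ K.card) {p q : ι → ℤ × ℤ}
    (hp : Set.InjOn p K) (hq : Set.InjOn q K)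
    (hpm : ∀ k ∈ K, p k ∈ rect (x₀ + (t + 1)) (x₁ - (t + 1)) (y₀ + (t + 1)) (y₁ - (t + 1)))
    (hqm : ∀ k ∈ K, q k ∈ rect (x₀' + (t + 1)) (x₁' - (t + 1)) (y₀' + (t + 1)) (y₁' - (t + 1)))
    (hadj : ∀ k ∈ K, G.Adj (φ (p k)) (φ' (q k))) : G.HasMinor (⊤ : SimpleGraph (Fin t)) := by
  obtain ⟨S, hS, hSc, hSs⟩ := exists_spread hp (by omega) hK
  obtain ⟨R, hR, hRc, hRs⟩ := exists_spread (hq.mono hS) (by omega) hSc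
  obtain ⟨k, hk⟩ := Finset.card_pos.1 ((pow_pos ht 2).trans_le hRc)
  have h1 := hpm k (hS (hR hk))
  have h2 := hqm k (hS (hR hk))
  rw [mem_rect] at h1 h2
  push_cast at hSs hRs
  exact hasMinor_of_links ht hRc (fun k hk => hadj k (hS (hR hk))) hdisj
    (h.links (by omega) (by omega) (fun k hk => hpm k (hS (hR hk))) (hSs.mono hR))
    (h'.links (by omega) (by omega) (fun k hk => hqm k (hS (hR hk))) hRs)

/-! ### Long jumps inside one chart -/

section Long

variable {ι : Type*}

lemma exists_half (P : ι → Prop) {K : Finset ι} {n : ℕ} (h : 2 * n ≤ K.card) :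
    (∃ K' ⊆ K, n ≤ K'.card ∧ ∀ k ∈ K', P k) ∨ ∃ K' ⊆ K, n ≤ K'.card ∧ ∀ k ∈ K', ¬ P k := by
  classical
  have := Finset.card_filter_add_card_filter_not (s := K) P
  by_cases h1 : n ≤ (K.filter P).card
  · exact Or.inl ⟨_, Finset.filter_subset _ _, h1, fun k hk => (Finset.mem_filter.1 hk).2⟩
  · exact Or.inr ⟨_, Finset.filter_subset _ _, by omega, fun k hk => (Finset.mem_filter.1 hk).2⟩

/-- Among intervals of which at most `c` share a common point, there are many pairwise disjoint
ones. -/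
lemma exists_disjoint_intervals (a b : ι → ℤ) {c : ℕ} (hc : 0 < c) (n : ℕ) (K : Finset ι)
    (hab : ∀ k ∈ K, a k ≤ b k) (hK : c * n ≤ K.card)
    (hcov : ∀ y, ∀ F ⊆ K, (∀ k ∈ F, a k ≤ y ∧ y ≤ b k) → F.card ≤ c) :
    ∃ K' ⊆ K, n ≤ K'.card ∧ ∀ k ∈ K', ∀ l ∈ K', k ≠ l → b k < a l ∨ b l < a k := by
  classical
  induction n generalizing K with
  | zero => exact ⟨∅, by simp, by simp, by simp⟩
  | succ n ih =>
    rw [mul_add, mul_one] at hK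
    obtain ⟨k₀, hk₀, hmin⟩ := K.exists_min_image b (Finset.card_pos.1 (by omega))
    have h1 := hcov (b k₀) (K.filter fun l => a l ≤ b k₀) (Finset.filter_subset _ _)
      fun k hk => ⟨(Finset.mem_filter.1 hk).2, hmin k (Finset.mem_filter.1 hk).1⟩
    have h2 := Finset.card_filter_add_card_filter_not (s := K) fun l => a l ≤ b k₀
    obtain ⟨K', hK', hn, hd⟩ := ih (K.filter fun l => ¬ a l ≤ b k₀)
      (fun k hk => hab k (Finset.mem_filter.1 hk).1) (by omega)
      fun y F hF => hcov y F (hF.trans (Finset.filter_subset _ _))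
    have h3 : ∀ l ∈ K', b k₀ < a l := fun l hl => not_le.1 (Finset.mem_filter.1 (hK' hl)).2
    have h4 : k₀ ∉ K' := fun h => (h3 k₀ h).not_ge (hab k₀ hk₀)
    refine ⟨insert k₀ K', Finset.insert_subset hk₀ (hK'.trans (Finset.filter_subset _ _)), ?_, ?_⟩
    · rw [Finset.card_insert_of_notMem h4]
      omega
    · intro k hk l hl hkl
      rcases Finset.mem_insert.1 hk with rfl | hk' <;>
        rcases Finset.mem_insert.1 hl with rfl | hl'
      · exact (hkl rfl).elim
      · exact Or.inl (h3 l hl')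
      · exact Or.inr (h3 k hk')
      · exact hd k hk' l hl' hkl

/-- The number of jumps that are long in a given direction that force a `K_t` minor. -/
def longBound (t : ℕ) : ℕ := (2 * crossBound t + 1) * t ^ 2

variable {V : Type*} {G : SimpleGraph V} {x₀ x₁ y₀ y₁ : ℤ} {φ : ℤ × ℤ → V} {t : ℕ}

lemma Chart.hasMinor_of_split (h : Chart G φ x₀ x₁ y₀ y₁) (ht : 0 < t) {K : Finset ι}
    (hK : crossBound t ≤ K.card) {p q : ι → ℤ × ℤ} (hp : Set.InjOn p K) (hq : Set.InjOn q K)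
    (hpm : ∀ k ∈ K, p k ∈ rect (x₀ + (t + 1)) (x₁ - (t + 1)) (y₀ + (t + 1)) (y₁ - (t + 1)))
    (hqm : ∀ k ∈ K, q k ∈ rect (x₀ + (t + 1)) (x₁ - (t + 1)) (y₀ + (t + 1)) (y₁ - (t + 1)))
    (hadj : ∀ k ∈ K, G.Adj (φ (p k)) (φ (q k))) {m : ℤ}
    (hpq : ∀ k ∈ K, (p k).2 + (t + 1) ≤ m ∧ m + 1 + (t + 1) ≤ (q k).2) :
    G.HasMinor (⊤ : SimpleGraph (Fin t)) := by
  rcases K.eq_empty_or_nonempty with rfl | ⟨k, hk⟩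
  · have : 0 < crossBound t := by unfold crossBound; positivity
    simp only [Finset.card_empty] at hK
    omega
  have h1 := hpm k hk
  have h2 := hqm k hk
  have h3 := hpq k hk
  rw [mem_rect] at h1 h2
  refine hasMinor_of_cross ht (h.mono le_rfl le_rfl le_rfl (y₁' := m) (by omega))
    (h.mono le_rfl le_rfl (y₀' := m + 1) (by omega) le_rfl) ?_ hK hp hq ?_ ?_ hadj
  · rw [Set.disjoint_left]
    rintro _ ⟨z, hz, rfl⟩ ⟨z', hz', hzz⟩
    rw [mem_rect] at hz hz'
    have := h.inj (by rw [mem_rect]; omega) (by rw [mem_rect]; omega) hzz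
    rw [this] at hz'
    omega
  · intro k hk
    have h1 := hpm k hk
    have h3 := hpq k hk
    rw [mem_rect] at *
    omega
  · intro k hk
    have h1 := hqm k hk
    have h3 := hpq k hk
    rw [mem_rect] at *
    omega

lemma Chart.hasMinor_of_long_snd (h : Chart G φ x₀ x₁ y₀ y₁) (ht : 0 < t) {K : Finset ι}
    (hK : longBound t ≤ K.card) {p q : ι → ℤ × ℤ} (hp : Set.InjOn p K) (hq : Set.InjOn q K)
    (hpm : ∀ k ∈ K, p k ∈ rect (x₀ + (t + 1)) (x₁ - (t + 1)) (y₀ + (t + 1)) (y₁ - (t + 1)))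
    (hqm : ∀ k ∈ K, q k ∈ rect (x₀ + (t + 1)) (x₁ - (t + 1)) (y₀ + (t + 1)) (y₁ - (t + 1)))
    (hadj : ∀ k ∈ K, G.Adj (φ (p k)) (φ (q k)))
    (hpq : ∀ k ∈ K, (p k).2 + (20 * t + 20) ≤ (q k).2) :
    G.HasMinor (⊤ : SimpleGraph (Fin t)) := by
  classical
  by_cases hcov : ∀ y, ∀ F ⊆ K, (∀ k ∈ F, (p k).2 ≤ y ∧ y ≤ (q k).2 + (2 * t + 2)) →
      F.card ≤ 2 * crossBound t + 1
  · obtain ⟨S, hS, hSc, hSd⟩ := exists_disjoint_intervals (fun k => (p k).2)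
      (fun k => (q k).2 + (2 * t + 2)) (by omega) (t ^ 2) K
      (fun k hk => by have := hpq k hk; omega) hK hcov
    obtain ⟨k, hk⟩ := Finset.card_pos.1 ((pow_pos ht 2).trans_le hSc)
    have h1 := hpm k (hS hk)
    rw [mem_rect] at h1
    refine hasMinor_of_links_sum ht hSc (fun k hk => hadj k (hS hk))
      (U := φ '' rect x₀ x₁ y₀ y₁) ?_
    have := h.links_of_snd (t := t) (by omega) (by omega) (K := S.disjSum S) (p := Sum.elim p q)
      (by
        rintro (k | k) hk
        · exact hpm k (hS (by simpa using hk))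
        · exact hqm k (hS (by simpa using hk)))
      (by
        rintro (k | k) hk (l | l) hl hkl <;>
          simp only [Finset.inl_mem_disjSum, Finset.inr_mem_disjSum] at hk hl <;>
          simp only [Sum.elim_inl, Sum.elim_inr] <;>
          have hk' := hpq k (hS hk) <;> have hl' := hpq l (hS hl) <;>
          have hd := hSd k hk l hl <;>
          rw [le_abs]
        · have := hd (fun h => hkl (h ▸ rfl))
          omega
        · by_cases hkl : k = l
          · subst hkl
            omega
          · have := hd hkl
            omega
        · by_cases hkl : k = l
          · subst hkl
            omega
          · have := hd hkl
            omega
        · have := hd (fun h => hkl (h ▸ rfl))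
          omega)
    rwa [Sum.comp_elim] at this
  · push Not at hcov
    obtain ⟨y, F, hF, hy, hFc⟩ := hcov
    rcases exists_half (fun k => (p k).2 + (10 * t + 10) ≤ y) (n := crossBound t)
      (by omega : _ ≤ F.card) with ⟨S, hS, hSc, hP⟩ | ⟨S, hS, hSc, hP⟩
    · have hSK := hS.trans hF
      refine h.hasMinor_of_split ht hSc (hp.mono hSK) (hq.mono hSK) (fun k hk => hpm k (hSK hk))
        (fun k hk => hqm k (hSK hk)) (fun k hk => hadj k (hSK hk)) (m := y - (6 * t + 6)) ?_
      intro k hk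
      have h1 := hP k hk
      have h2 := hy k (hS hk)
      omega
    · have hSK := hS.trans hF
      refine h.hasMinor_of_split ht hSc (hp.mono hSK) (hq.mono hSK) (fun k hk => hpm k (hSK hk))
        (fun k hk => hqm k (hSK hk)) (fun k hk => hadj k (hSK hk)) (m := y + (4 * t + 4)) ?_
      intro k hk
      have h1 := hP k hk
      have h2 := hy k (hS hk)
      have h3 := hpq k (hSK hk)
      omega

lemma Chart.hasMinor_of_long_snd_abs (h : Chart G φ x₀ x₁ y₀ y₁) (ht : 0 < t) {K : Finset ι}
    (hK : 2 * longBound t ≤ K.card) {p q : ι → ℤ × ℤ} (hp : Set.InjOn p K) (hq : Set.InjOn q K)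
    (hpm : ∀ k ∈ K, p k ∈ rect (x₀ + (t + 1)) (x₁ - (t + 1)) (y₀ + (t + 1)) (y₁ - (t + 1)))
    (hqm : ∀ k ∈ K, q k ∈ rect (x₀ + (t + 1)) (x₁ - (t + 1)) (y₀ + (t + 1)) (y₁ - (t + 1)))
    (hadj : ∀ k ∈ K, G.Adj (φ (p k)) (φ (q k)))
    (hpq : ∀ k ∈ K, 20 * t + 20 ≤ |(p k).2 - (q k).2|) :
    G.HasMinor (⊤ : SimpleGraph (Fin t)) := by
  rcases exists_half (fun k => (p k).2 ≤ (q k).2) hK with ⟨S, hS, hSc, hP⟩ | ⟨S, hS, hSc, hP⟩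
  · refine h.hasMinor_of_long_snd ht hSc (hp.mono hS) (hq.mono hS) (fun k hk => hpm k (hS hk))
      (fun k hk => hqm k (hS hk)) (fun k hk => hadj k (hS hk)) fun k hk => ?_
    have h1 := hpq k (hS hk)
    have h2 := hP k hk
    rw [abs_of_nonpos (by omega)] at h1
    omega
  · refine h.hasMinor_of_long_snd ht hSc (hq.mono hS) (hp.mono hS) (fun k hk => hqm k (hS hk))
      (fun k hk => hpm k (hS hk)) (fun k hk => (hadj k (hS hk)).symm) fun k hk => ?_
    have h1 := hpq k (hS hk)
    have h2 := hP k hk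
    rw [abs_of_nonneg (by omega)] at h1
    omega

lemma Chart.hasMinor_of_long (h : Chart G φ x₀ x₁ y₀ y₁) (ht : 0 < t) {K : Finset ι}
    (hK : 4 * longBound t ≤ K.card) {p q : ι → ℤ × ℤ} (hp : Set.InjOn p K) (hq : Set.InjOn q K)
    (hpm : ∀ k ∈ K, p k ∈ rect (x₀ + (t + 1)) (x₁ - (t + 1)) (y₀ + (t + 1)) (y₁ - (t + 1)))
    (hqm : ∀ k ∈ K, q k ∈ rect (x₀ + (t + 1)) (x₁ - (t + 1)) (y₀ + (t + 1)) (y₁ - (t + 1)))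
    (hadj : ∀ k ∈ K, G.Adj (φ (p k)) (φ (q k)))
    (hpq : ∀ k ∈ K, 20 * t + 20 ≤ |(p k).1 - (q k).1| ∨ 20 * t + 20 ≤ |(p k).2 - (q k).2|) :
    G.HasMinor (⊤ : SimpleGraph (Fin t)) := by
  rcases exists_half (fun k => 20 * t + 20 ≤ |(p k).1 - (q k).1|) (n := 2 * longBound t)
    (by omega : _ ≤ K.card) with ⟨S, hS, hSc, hP⟩ | ⟨S, hS, hSc, hP⟩
  · refine h.swap.hasMinor_of_long_snd_abs ht hSc (p := Prod.swap ∘ p) (q := Prod.swap ∘ q)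
      (Prod.swap_injective.comp_injOn (hp.mono hS)) (Prod.swap_injective.comp_injOn (hq.mono hS))
      ?_ ?_ (fun k hk => by simpa using hadj k (hS hk)) (fun k hk => by simpa using hP k hk)
    · intro k hk
      have := hpm k (hS hk)
      simp only [mem_rect, Function.comp, Prod.fst_swap, Prod.snd_swap] at *
      omega
    · intro k hk
      have := hqm k (hS hk)
      simp only [mem_rect, Function.comp, Prod.fst_swap, Prod.snd_swap] at *
      omega
  · exact h.hasMinor_of_long_snd_abs ht hSc (hp.mono hS) (hq.mono hS) (fun k hk => hpm k (hS hk))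
      (fun k hk => hqm k (hS hk)) (fun k hk => hadj k (hS hk))
      fun k hk => (hpq k (hS hk)).resolve_left (hP k hk)

end Long

/-! ### Short jumps inside one chart -/

/-- Every unit cell of the rectangle `[x₀, x₁] × [y₀, y₁]` contains a diagonal of `Γ`. -/
def DiagOn (Γ : SimpleGraph (ℤ × ℤ)) (x₀ x₁ y₀ y₁ : ℤ) : Prop :=
  ∀ x y, x₀ ≤ x → x + 1 ≤ x₁ → y₀ ≤ y → y + 1 ≤ y₁ →
    Γ.Adj (x, y) (x + 1, y + 1) ∨ Γ.Adj (x + 1, y) (x, y + 1)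

section Crossing

/-- In the box `[a, b] × [c, d]` there are two disjoint, adjacent connected sets that exchange
their vertical order. -/
def Crossing (Γ : SimpleGraph (ℤ × ℤ)) (a b c d : ℤ) : Prop :=
  ∃ (h h' : ℤ) (A B : Set (ℤ × ℤ)), a < h' ∧ h' ≤ b ∧ a ≤ h ∧ h < b ∧
    (Γ.induce A).Connected ∧ (Γ.induce B).Connected ∧ (∀ z ∈ A, z ∉ B) ∧
    (∀ z ∈ A ∪ B, a ≤ z.1 ∧ z.1 ≤ b ∧ c ≤ z.2 ∧ z.2 ≤ d) ∧
    (h, c) ∈ A ∧ (b, c) ∈ B ∧ (a, d) ∈ B ∧ (h', d) ∈ A ∧ ∃ u ∈ A, ∃ v ∈ B, Γ.Adj u v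

variable {Γ Γ₀ : SimpleGraph (ℤ × ℤ)} {a b c d : ℤ} {s r : ℤ × ℤ}

lemma GridOn.crossing_base (hG : GridOn Γ a b c d) (hsr : Γ.Adj s r)
    (hs : s ∈ rect (a + 2) (b - 2) (c + 2) (d - 2)) (hr : r ∈ rect (a + 2) (b - 2) (c + 2) (d - 2))
    {B : Set (ℤ × ℤ)} (hB : (Γ.induce B).Connected)
    (hAB : ∀ z ∈ B, z ∉ hseg s.1 c s.2 ∧ z ∉ hseg r.1 r.2 d)
    (hBm : ∀ z ∈ B, a ≤ z.1 ∧ z.1 ≤ b ∧ c ≤ z.2 ∧ z.2 ≤ d) (h₁ : (b, c) ∈ B) (h₂ : (a, d) ∈ B)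
    (hadj : ∃ v ∈ B, Γ.Adj s v) : Crossing Γ a b c d := by
  rw [mem_rect] at hs hr
  have hsA : s ∈ hseg s.1 c s.2 := ⟨rfl, by omega, le_rfl⟩
  refine ⟨s.1, r.1, hseg s.1 c s.2 ∪ hseg r.1 r.2 d, B, by omega, by omega, by omega, by omega,
    induce_union_connected_of_adj
      (hG.hseg_connected (by omega) (by omega) le_rfl (by omega) (by omega))
      (hG.hseg_connected (by omega) (by omega) (by omega) (by omega) le_rfl)
      hsA (w := r) ⟨rfl, le_rfl, by omega⟩ hsr, hB, ?_, ?_,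
    Or.inl ⟨rfl, le_rfl, by omega⟩, h₁, h₂, Or.inr ⟨rfl, by omega, le_rfl⟩, s, Or.inl hsA, hadj⟩
  · rintro z (hz | hz) hzB
    · exact (hAB z hzB).1 hz
    · exact (hAB z hzB).2 hz
  · rintro z ((hz | hz) | hz)
    · rw [mem_hseg] at hz
      omega
    · rw [mem_hseg] at hz
      omega
    · exact hBm z hz

lemma GridOn.crossing_of_fst (hG : GridOn Γ a b c d) (hsr : Γ.Adj s r)
    (hs : s ∈ rect (a + 2) (b - 2) (c + 2) (d - 2)) (hr : r ∈ rect (a + 2) (b - 2) (c + 2) (d - 2))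
    (h : s.1 + 2 ≤ r.1) : Crossing Γ a b c d := by
  refine hG.crossing_base hsr hs hr
    (B := vseg c (s.1 + 1) b ∪ hseg (s.1 + 1) c d ∪ vseg d a (s.1 + 1)) ?_ ?_ ?_ ?_ ?_ ?_ <;>
    rw [mem_rect] at hs hr
  · refine induce_union_connected_of_mem (v := (s.1 + 1, d))
      (induce_union_connected_of_mem (v := (s.1 + 1, c))
        (hG.vseg_connected (by omega) (by omega) (by omega) (by omega) (by omega))
        (hG.hseg_connected (by omega) (by omega) (by omega) (by omega) (by omega)) ?_ ?_)
        (hG.vseg_connected (by omega) (by omega) (by omega) (by omega) (by omega)) ?_ ?_ <;>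
    simp only [Set.mem_union, mem_hseg, mem_vseg, true_and] <;> omega
  · intro z
    simp only [Set.mem_union, mem_hseg, mem_vseg]
    omega
  · intro z
    simp only [Set.mem_union, mem_hseg, mem_vseg]
    omega
  · simp only [Set.mem_union, mem_hseg, mem_vseg, true_and]
    omega
  · simp only [Set.mem_union, mem_hseg, mem_vseg, true_and]
    omega
  · refine ⟨(s.1 + 1, s.2), ?_, hG.vert s.1 s.2 (by omega) (by omega) (by omega) (by omega)⟩
    simp only [Set.mem_union, mem_hseg, mem_vseg, true_and]
    omega

lemma GridOn.crossing_of_snd (hG : GridOn Γ a b c d) (hsr : Γ.Adj s r)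
    (hs : s ∈ rect (a + 2) (b - 2) (c + 2) (d - 2)) (hr : r ∈ rect (a + 2) (b - 2) (c + 2) (d - 2))
    (h : s.2 + 2 ≤ r.2) : Crossing Γ a b c d := by
  refine hG.crossing_base hsr hs hr
    (B := hseg b c (s.2 + 1) ∪ vseg (s.2 + 1) a b ∪ hseg a (s.2 + 1) d) ?_ ?_ ?_ ?_ ?_ ?_ <;>
    rw [mem_rect] at hs hr
  · refine induce_union_connected_of_mem (v := (a, s.2 + 1))
      (induce_union_connected_of_mem (v := (b, s.2 + 1))
        (hG.hseg_connected (by omega) (by omega) (by omega) (by omega) (by omega))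
        (hG.vseg_connected (by omega) (by omega) (by omega) (by omega) (by omega)) ?_ ?_)
        (hG.hseg_connected (by omega) (by omega) (by omega) (by omega) (by omega)) ?_ ?_ <;>
    simp only [Set.mem_union, mem_hseg, mem_vseg, true_and] <;> omega
  · intro z
    simp only [Set.mem_union, mem_hseg, mem_vseg]
    omega
  · intro z
    simp only [Set.mem_union, mem_hseg, mem_vseg]
    omega
  · simp only [Set.mem_union, mem_hseg, mem_vseg, true_and]
    omega
  · simp only [Set.mem_union, mem_hseg, mem_vseg, true_and]
    omega
  · refine ⟨(s.1, s.2 + 1), ?_, hG.horiz s.1 s.2 (by omega) (by omega) (by omega) (by omega)⟩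
    simp only [Set.mem_union, mem_hseg, mem_vseg, true_and]
    omega

lemma GridOn.crossing_of_diag (hG : GridOn Γ a b c d) (hsr : Γ.Adj s r)
    (hs : s ∈ rect (a + 2) (b - 2) (c + 2) (d - 2)) (hr : r ∈ rect (a + 2) (b - 2) (c + 2) (d - 2))
    (h₁ : r.1 = s.1 + 1) (h₂ : r.2 = s.2 + 1) (hd : Γ.Adj (s.1 + 1, s.2) (s.1, s.2 + 1)) :
    Crossing Γ a b c d := by
  refine hG.crossing_base hsr hs hr
    (B := (hseg b c s.2 ∪ vseg s.2 (s.1 + 1) b) ∪ (vseg (s.2 + 1) a s.1 ∪ hseg a (s.2 + 1) d))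
    ?_ ?_ ?_ ?_ ?_ ?_ <;> rw [mem_rect] at hs hr
  · refine induce_union_connected_of_adj
      (induce_union_connected_of_mem (v := (b, s.2))
        (hG.hseg_connected (by omega) (by omega) (by omega) (by omega) (by omega))
        (hG.vseg_connected (by omega) (by omega) (by omega) (by omega) (by omega)) ?_ ?_)
      (induce_union_connected_of_mem (v := (a, s.2 + 1))
        (hG.vseg_connected (by omega) (by omega) (by omega) (by omega) (by omega))
        (hG.hseg_connected (by omega) (by omega) (by omega) (by omega) (by omega)) ?_ ?_)
      ?_ ?_ hd <;>
    simp only [Set.mem_union, mem_hseg, mem_vseg, true_and] <;> omega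
  · intro z
    simp only [Set.mem_union, mem_hseg, mem_vseg]
    omega
  · intro z
    simp only [Set.mem_union, mem_hseg, mem_vseg]
    omega
  · simp only [Set.mem_union, mem_hseg, mem_vseg, true_and]
    omega
  · simp only [Set.mem_union, mem_hseg, mem_vseg, true_and]
    omega
  · refine ⟨(s.1 + 1, s.2), ?_, hG.vert s.1 s.2 (by omega) (by omega) (by omega) (by omega)⟩
    simp only [Set.mem_union, mem_hseg, mem_vseg, true_and]
    omega

lemma GridOn.crossing_of_antidiag (hG : GridOn Γ a b c d) (hsr : Γ.Adj s r)
    (hs : s ∈ rect (a + 2) (b - 2) (c + 2) (d - 2)) (hr : r ∈ rect (a + 2) (b - 2) (c + 2) (d - 2))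
    (h₁ : s.1 = r.1 + 1) (h₂ : r.2 = s.2 + 1) (hd : Γ.Adj (r.1, s.2) (r.1 + 1, s.2 + 1)) :
    Crossing Γ a b c d := by
  refine hG.crossing_base hsr hs hr
    (B := (hseg a s.2 d ∪ vseg s.2 a r.1) ∪
      (vseg (s.2 + 1) (r.1 + 1) b ∪ hseg b c (s.2 + 1)))
    ?_ ?_ ?_ ?_ ?_ ?_ <;> rw [mem_rect] at hs hr
  · refine induce_union_connected_of_adj
      (induce_union_connected_of_mem (v := (a, s.2))
        (hG.hseg_connected (by omega) (by omega) (by omega) (by omega) (by omega))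
        (hG.vseg_connected (by omega) (by omega) (by omega) (by omega) (by omega)) ?_ ?_)
      (induce_union_connected_of_mem (v := (b, s.2 + 1))
        (hG.vseg_connected (by omega) (by omega) (by omega) (by omega) (by omega))
        (hG.hseg_connected (by omega) (by omega) (by omega) (by omega) (by omega)) ?_ ?_)
      ?_ ?_ hd <;>
    simp only [Set.mem_union, mem_hseg, mem_vseg, true_and] <;> omega
  · intro z
    simp only [Set.mem_union, mem_hseg, mem_vseg]
    omega
  · intro z
    simp only [Set.mem_union, mem_hseg, mem_vseg]
    omega
  · simp only [Set.mem_union, mem_hseg, mem_vseg, true_and]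
    omega
  · simp only [Set.mem_union, mem_hseg, mem_vseg, true_and]
    omega
  · refine ⟨(s.1, s.2 + 1), ?_, hG.horiz s.1 s.2 (by omega) (by omega) (by omega) (by omega)⟩
    simp only [Set.mem_union, mem_hseg, mem_vseg, true_and]
    omega

lemma GridOn.crossing (hG : GridOn Γ₀ a b c d) (hD : DiagOn Γ₀ a b c d) (hle : Γ₀ ≤ Γ)
    (hs : s ∈ rect (a + 2) (b - 2) (c + 2) (d - 2)) (hr : r ∈ rect (a + 2) (b - 2) (c + 2) (d - 2))
    (hsr : Γ.Adj s r) (hn : ¬ Γ₀.Adj s r) : Crossing Γ a b c d := by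
  wlog h2 : s.2 ≤ r.2 generalizing s r
  · exact this hr hs hsr.symm (fun h => hn h.symm) (by omega)
  have hG' : GridOn Γ a b c d := ⟨fun x y h1 h2 h3 h4 => hle (hG.horiz x y h1 h2 h3 h4),
    fun x y h1 h2 h3 h4 => hle (hG.vert x y h1 h2 h3 h4)⟩
  by_cases h3 : s.2 + 2 ≤ r.2
  · exact hG'.crossing_of_snd hsr hs hr h3
  by_cases h4 : s.1 + 2 ≤ r.1
  · exact hG'.crossing_of_fst hsr hs hr h4
  by_cases h5 : r.1 + 2 ≤ s.1
  · exact hG'.crossing_of_fst hsr.symm hr hs h5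
  obtain ⟨x, y⟩ := s
  obtain ⟨x', y'⟩ := r
  have hs' := hs
  have hr' := hr
  rw [mem_rect] at hs' hr'
  simp only at *
  have hy : y' = y ∨ y' = y + 1 := by omega
  have hx : x' = x ∨ x' = x + 1 ∨ x = x' + 1 := by omega
  rcases hy with rfl | rfl <;> rcases hx with rfl | rfl | rfl
  · exact (hsr.ne rfl).elim
  · exact (hn (hG.vert _ _ (by omega) (by omega) (by omega) (by omega))).elim
  · exact (hn (hG.vert _ _ (by omega) (by omega) (by omega) (by omega)).symm).elim
  · exact (hn (hG.horiz _ _ (by omega) (by omega) (by omega) (by omega))).elim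
  · exact hG'.crossing_of_diag hsr hs hr rfl rfl
      (hle ((hD x y (by omega) (by omega) (by omega) (by omega)).resolve_left hn))
  · exact hG'.crossing_of_antidiag hsr hs hr rfl rfl
      (hle ((hD x' y (by omega) (by omega) (by omega) (by omega)).resolve_right hn))

end Crossing

lemma Bundle.extend_crossing {t : ℕ} {Γ : SimpleGraph (ℤ × ℤ)} {x₀ x₁ y₀ y₁ e : ℤ}
    {σ : Equiv.Perm (Fin t)} {B : Fin t → Set (ℤ × ℤ)} (h : Bundle Γ x₀ x₁ y₀ e σ B)
    (hG : GridOn Γ x₀ x₁ y₀ y₁) (hy : y₀ ≤ e) {a b c d : ℤ} (hc : e + t + 1 ≤ c) (hcd : c ≤ d)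
    (hd : d + t + 1 ≤ y₁) (ha : x₀ + t ≤ a) (hb : b + t ≤ x₁) (hX : Crossing Γ a b c d)
    {p p' : Fin t} (hp : p.val + 1 = p'.val) :
    ∃ B' : Fin t → Set (ℤ × ℤ), Bundle Γ x₀ x₁ y₀ (d + t + 1) (σ.trans (Equiv.swap p p')) B' ∧
      (∀ i, B i ⊆ B' i) ∧ ∃ u ∈ B' (σ.symm p), ∃ v ∈ B' (σ.symm p'), Γ.Adj u v := by
  obtain ⟨hh, hh', A, A', h1, h2, h3, h4, hA, hA', hdisj, hm, hA1, hA'1, hA'2, hA2, u₀, hu₀, v₀,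
    hv₀, huv⟩ := hX
  have hpt := p'.isLt
  have hpp : p ≠ p' := by
    rintro rfl
    omega
  have hval : ∀ {q r : Fin t}, q ≠ r → q.val ≠ r.val := fun h h' => h (Fin.ext h')
  have hval' : ∀ q r : Fin t, q = r ∧ q.val = r.val ∨ ¬ q = r ∧ q.val ≠ r.val := by
    intro q r
    rw [Fin.ext_iff]
    omega
  set u : Fin t → ℤ := fun q =>
    if q.val < p.val then a - (p.val - q.val) else if q = p then hh
    else b + (q.val - p'.val) with hu
  set v : Fin t → ℤ := fun q =>
    if q.val ≤ p.val then a - (p.val - q.val) else if q = p' then hh' else b + (q.val - p'.val)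
    with hv
  set S : Fin t → Set (ℤ × ℤ) := fun q =>
    if q = p then A else if q = p' then A' else hseg (u q) c d with hS
  have hum : StrictMono u := by
    intro q r hqr
    have h5 := hval' q p
    have h6 := hval' r p
    simp only [Fin.lt_def] at hqr
    simp only [hu]
    split_ifs <;> omega
  have hvm : StrictMono v := by
    intro q r hqr
    have h5 := hval' q p'
    have h6 := hval' r p'
    simp only [Fin.lt_def] at hqr
    simp only [hv]
    split_ifs <;> omega
  have hup : u p = hh := by simp [hu]
  have hup' : u p' = b := by
    simp only [hu]
    split_ifs with h5 h6
    · omega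
    · exact (hpp h6.symm).elim
    · omega
  have hvp : v p = a := by simp [hv]
  have hvp' : v p' = hh' := by
    simp only [hv]
    split_ifs with h5
    · omega
    · rfl
  have hne : ∀ q, q ≠ p → q ≠ p' → u q = v q ∧ (u q < a ∨ b < u q) := by
    intro q hq hq'
    have := hval hq
    have := hval hq'
    simp only [hu, hv, if_neg hq, if_neg hq']
    split_ifs <;> omega
  have hSp : S p = A := by simp [hS]
  have hSp' : S p' = A' := by simp [hS, hpp.symm]
  have hSq : ∀ q, q ≠ p → q ≠ p' → S q = hseg (u q) c d := fun q hq hq' => by simp [hS, hq, hq']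
  have hbounds : ∀ q, (x₀ + q.val ≤ u q ∧ u q ≤ x₁) ∧ (x₀ + q.val ≤ v q ∧ v q ≤ x₁) := by
    intro q
    have := q.isLt
    refine ⟨?_, ?_⟩
    · simp only [hu]
      split_ifs with h5 h6
      · omega
      · have := congrArg Fin.val h6
        omega
      · have := hval h6
        omega
    · simp only [hv]
      split_ifs with h5 h6
      · omega
      · have := congrArg Fin.val h6
        omega
      · have := hval h6
        omega
  obtain ⟨B', hB', hsub, hSB⟩ := h.extend hG hy hc hcd hd hum hvm (fun q => (hbounds q).1.1)
    (fun q => (hbounds q).1.2) (fun q => (hbounds q).2.1) (fun q => (hbounds q).2.2)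
    (π := Equiv.swap p p') (S := S)
    (by
      intro q
      by_cases hq : q = p
      · rw [hq, hSp]
        exact hA
      by_cases hq' : q = p'
      · rw [hq', hSp']
        exact hA'
      rw [hSq q hq hq']
      have := hbounds q
      exact hG.hseg_connected (by omega) (by omega) (by omega) hcd (by omega))
    (by
      have key : ∀ q, q ≠ p → q ≠ p' → ∀ z ∈ S q, z.1 < a ∨ b < z.1 := by
        intro q hq hq' z hz
        rw [hSq q hq hq', mem_hseg] at hz
        have := (hne q hq hq').2
        omega
      have key' : ∀ q, (q = p ∨ q = p') → ∀ z ∈ S q, a ≤ z.1 ∧ z.1 ≤ b := by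
        rintro q (rfl | rfl) z hz
        · rw [hSp] at hz
          have := hm z (Or.inl hz)
          omega
        · rw [hSp'] at hz
          have := hm z (Or.inr hz)
          omega
      intro q r hqr z hz hz'
      by_cases hq : q = p ∨ q = p' <;> by_cases hr : r = p ∨ r = p'
      · rcases hq with rfl | rfl <;> rcases hr with rfl | rfl
        · exact hqr rfl
        · rw [hSp] at hz
          rw [hSp'] at hz'
          exact hdisj z hz hz'
        · rw [hSp'] at hz
          rw [hSp] at hz'
          exact hdisj z hz' hz
        · exact hqr rfl
      · have := key' q hq z hz
        have := key r (fun h => hr (Or.inl h)) (fun h => hr (Or.inr h)) z hz'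
        omega
      · have := key' r hr z hz'
        have := key q (fun h => hq (Or.inl h)) (fun h => hq (Or.inr h)) z hz
        omega
      · push Not at hq hr
        rw [hSq q hq.1 hq.2, mem_hseg] at hz
        rw [hSq r hr.1 hr.2, mem_hseg] at hz'
        exact hqr (hum.injective (hz.1.symm.trans hz'.1)))
    (by
      intro q z hz
      by_cases hq : q = p
      · rw [hq, hSp] at hz
        have := hm z (Or.inl hz)
        omega
      by_cases hq' : q = p'
      · rw [hq', hSp'] at hz
        have := hm z (Or.inr hz)
        omega
      rw [hSq q hq hq', mem_hseg] at hz
      have := hbounds q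
      omega)
    (by
      intro q
      by_cases hq : q = p
      · rwa [hq, hSp, hup]
      by_cases hq' : q = p'
      · rwa [hq', hSp', hup']
      rw [hSq q hq hq']
      exact ⟨rfl, le_rfl, hcd⟩)
    (by
      intro q
      by_cases hq : q = p
      · rwa [hq, hSp, Equiv.swap_apply_left, hvp']
      by_cases hq' : q = p'
      · rwa [hq', hSp', Equiv.swap_apply_right, hvp]
      rw [hSq q hq hq', Equiv.swap_apply_of_ne_of_ne hq hq', ← (hne q hq hq').1]
      exact ⟨rfl, hcd, le_rfl⟩)
  have hp1 := hSB (σ.symm p)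
  have hp2 := hSB (σ.symm p')
  rw [Equiv.apply_symm_apply] at hp1 hp2
  rw [hSp] at hp1
  rw [hSp'] at hp2
  exact ⟨B', hB', hsub, u₀, hp1 hu₀, v₀, hp2 hv₀, huv⟩

/-! ### Sorting networks -/

/-- If at each step two neighbouring elements of a permutation can be exchanged and thereby
marked, then after `t ^ 3` steps all pairs can be marked. -/
lemma exists_all_marked {t N : ℕ} (hN : t ^ 3 ≤ N)
    (P : ℕ → Equiv.Perm (Fin t) → Set (Sym2 (Fin t)) → Prop) (h₀ : P 0 1 ∅)
    (hstep : ∀ n < N, ∀ σ D, P n σ D → ∀ p p' : Fin t, p.val + 1 = p'.val →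
      P (n + 1) (σ.trans (Equiv.swap p p')) (insert s(σ.symm p, σ.symm p') D)) :
    ∃ n σ D, P n σ D ∧ ∀ i j, i ≠ j → s(i, j) ∈ D := by
  classical
  have one : ∀ d n σ D i j, P n σ D → (σ i).val + d + 1 = (σ j).val → n + d + 1 ≤ N →
      ∃ n' ≤ n + d + 1, ∃ σ' D', P n' σ' D' ∧ D ⊆ D' ∧ s(i, j) ∈ D' := by
    intro d
    induction d with
    | zero =>
      intro n σ D i j hP hij hn
      exact ⟨n + 1, le_rfl, _, _, hstep n (by omega) σ D hP (σ i) (σ j) hij,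
        Set.subset_insert _ _, by simp⟩
    | succ d ih =>
      intro n σ D i j hP hij hn
      have hj := (σ j).isLt
      have h1 := hstep n (by omega) σ D hP (σ i) ⟨(σ i).val + 1, by omega⟩ rfl
      obtain ⟨n', hn', σ', D', hP', hD, hm⟩ := ih _ _ _ i j h1 (by
        rw [Equiv.trans_apply, Equiv.trans_apply, Equiv.swap_apply_left,
          Equiv.swap_apply_of_ne_of_ne]
        · simp only
          omega
        · intro h
          rw [h] at hij
          omega
        · intro h
          rw [h] at hij
          simp only at hij
          omega) (by omega)
      exact ⟨n', by omega, σ', D', hP', (Set.subset_insert _ _).trans hD, hm⟩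
  have all : ∀ F : Finset (Fin t × Fin t), ∃ n ≤ F.card * t, ∃ σ D, P n σ D ∧
      ∀ x ∈ F, x.1 ≠ x.2 → s(x.1, x.2) ∈ D := by
    intro F
    induction F using Finset.induction_on with
    | empty => exact ⟨0, by simp, 1, ∅, h₀, by simp⟩
    | insert x F hx ih =>
      obtain ⟨n, hn, σ, D, hP, hD⟩ := ih
      rw [Finset.card_insert_of_notMem hx, Nat.succ_mul]
      by_cases hxx : x.1 = x.2
      · refine ⟨n, by omega, σ, D, hP, fun y hy hne => ?_⟩
        rcases Finset.mem_insert.1 hy with rfl | hy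
        · exact (hne hxx).elim
        · exact hD y hy hne
      · have hcard : (insert x F).card ≤ t ^ 2 := by
          simpa [sq] using Finset.card_le_univ (insert x F)
        rw [Finset.card_insert_of_notMem hx] at hcard
        have hN' : F.card * t + t ≤ N := by
          refine le_trans ?_ hN
          have := Nat.mul_le_mul_right t hcard
          rw [add_mul, one_mul] at this
          rwa [pow_succ]
        have hne : (σ x.1).val ≠ (σ x.2).val := fun h => hxx (σ.injective (Fin.ext h))
        have b1 := (σ x.1).isLt
        have b2 := (σ x.2).isLt
        obtain ⟨n', hn', σ', D', hP', hDD, hm⟩ : ∃ n' ≤ n + t, ∃ σ' D', P n' σ' D' ∧ D ⊆ D' ∧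
            s(x.1, x.2) ∈ D' := by
          rcases Nat.lt_or_gt_of_ne hne with hlt | hlt
          · obtain ⟨n', hn', h⟩ := one ((σ x.2).val - (σ x.1).val - 1) n σ D x.1 x.2 hP
              (by omega) (by omega)
            exact ⟨n', by omega, h⟩
          · obtain ⟨n', hn', σ', D', h1, h2, h3⟩ := one ((σ x.1).val - (σ x.2).val - 1) n σ D
              x.2 x.1 hP (by omega) (by omega)
            exact ⟨n', by omega, σ', D', h1, h2, by rwa [Sym2.eq_swap]⟩
        refine ⟨n', by omega, σ', D', hP', fun y hy hne => ?_⟩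
        rcases Finset.mem_insert.1 hy with rfl | hy
        · exact hm
        · exact hDD (hD y hy hne)
  obtain ⟨n, -, σ, D, hP, hD⟩ := all Finset.univ
  exact ⟨n, σ, D, hP, fun i j hij => hD (i, j) (Finset.mem_univ _) hij⟩

section Short

variable {ι V : Type*} {G H : SimpleGraph V} {x₀ x₁ y₀ y₁ : ℤ} {φ : ℤ × ℤ → V} {t : ℕ}

lemma DiagOn.swap {Γ : SimpleGraph (ℤ × ℤ)} (h : DiagOn Γ x₀ x₁ y₀ y₁) :
    DiagOn (Γ.comap Prod.swap) y₀ y₁ x₀ x₁ :=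
  fun x y h1 h2 h3 h4 => (h y x h3 h4 h1 h2).imp id fun h' => h'.symm

lemma DiagOn.mono {Γ : SimpleGraph (ℤ × ℤ)} (h : DiagOn Γ x₀ x₁ y₀ y₁) {x₀' x₁' y₀' y₁' : ℤ}
    (h1 : x₀ ≤ x₀') (h2 : x₁' ≤ x₁) (h3 : y₀ ≤ y₀') (h4 : y₁' ≤ y₁) :
    DiagOn Γ x₀' x₁' y₀' y₁' :=
  fun _ _ _ _ _ _ => h _ _ (by omega) (by omega) (by omega) (by omega)

lemma Chart.mono_graph (h : Chart H φ x₀ x₁ y₀ y₁) (hle : H ≤ G) : Chart G φ x₀ x₁ y₀ y₁ :=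
  ⟨h.inj, fun x y h1 h2 h3 h4 => hle (h.grid.horiz x y h1 h2 h3 h4),
    fun x y h1 h2 h3 h4 => hle (h.grid.vert x y h1 h2 h3 h4)⟩

lemma Bundle.hasMinor (hφ : Set.InjOn φ (rect x₀ x₁ y₀ y₁)) {e : ℤ} (he : e ≤ y₁)
    {σ : Equiv.Perm (Fin t)} {B : Fin t → Set (ℤ × ℤ)}
    (h : Bundle (G.comap φ) x₀ x₁ y₀ e σ B)
    (hadj : ∀ i j, i ≠ j → ∃ u ∈ B i, ∃ v ∈ B j, (G.comap φ).Adj u v) :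
    G.HasMinor (⊤ : SimpleGraph (Fin t)) := by
  have hm : ∀ i, ∀ z ∈ B i, z ∈ rect x₀ x₁ y₀ y₁ := fun i z hz => by
    have := h.mem i z hz
    rw [mem_rect]
    omega
  refine ⟨fun i => φ '' B i, fun i => induce_image_connected φ (h.conn i), fun i j hij => ?_,
    fun i j hij => ?_⟩
  · refine Set.disjoint_left.2 ?_
    rintro _ ⟨z, hz, rfl⟩ ⟨z', hz', hzz⟩
    rw [hφ (hm _ _ hz') (hm _ _ hz) hzz] at hz'
    exact h.disj i j hij z hz hz'
  · obtain ⟨u, hu, v, hv, huv⟩ := hadj i j hij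
    exact ⟨_, ⟨u, hu, rfl⟩, _, ⟨v, hv, rfl⟩, huv⟩

lemma Chart.hasMinor_of_short_snd (h : Chart H φ x₀ x₁ y₀ y₁) (hD : DiagOn (H.comap φ) x₀ x₁ y₀ y₁)
    (hle : H ≤ G) (ht : 0 < t) {K : Finset ι} (hK : t ^ 3 ≤ K.card) {p q : ι → ℤ × ℤ}
    (hpm : ∀ k ∈ K, p k ∈
      rect (x₀ + (30 * t + 30)) (x₁ - (30 * t + 30)) (y₀ + (30 * t + 30)) (y₁ - (30 * t + 30)))
    (hadj : ∀ k ∈ K, G.Adj (φ (p k)) (φ (q k))) (hn : ∀ k ∈ K, ¬ H.Adj (φ (p k)) (φ (q k)))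
    (hpq : ∀ k ∈ K, |(p k).1 - (q k).1| < 20 * t + 20 ∧ |(p k).2 - (q k).2| < 20 * t + 20)
    (hsep : ∀ k ∈ K, ∀ l ∈ K, k ≠ l → 42 * (t : ℤ) + 46 ≤ |(p k).2 - (p l).2|) :
    G.HasMinor (⊤ : SimpleGraph (Fin t)) := by
  classical
  have hG := (h.mono_graph hle).grid
  obtain ⟨k₀, hk₀⟩ := Finset.card_pos.1 ((pow_pos ht 3).trans_le hK)
  have hm₀ := hpm k₀ hk₀
  rw [mem_rect] at hm₀
  let P : ℕ → Equiv.Perm (Fin t) → Set (Sym2 (Fin t)) → Prop := fun n σ D =>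
    ∃ R ⊆ K, K.card ≤ R.card + n ∧ ∃ e B, Bundle (G.comap φ) x₀ x₁ y₀ e σ B ∧ y₀ ≤ e ∧ e ≤ y₁ ∧
      (∀ k ∈ R, e + (21 * t + 23) ≤ (p k).2) ∧
      ∀ i j, s(i, j) ∈ D → ∃ u ∈ B i, ∃ v ∈ B j, (G.comap φ).Adj u v
  obtain ⟨n, σ, D, ⟨R, -, -, e, B, hB, -, he, -, hBD⟩, hD⟩ := exists_all_marked hK P
    ⟨K, subset_rfl, by simp, y₀, _, bundle_start (by omega), le_rfl, by omega, fun k hk => by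
      have := hpm k hk
      rw [mem_rect] at this
      omega, by simp⟩
    (by
      rintro n hn' σ D ⟨R, hRK, hR, e, B, hB, he, he', hRe, hBD⟩ i i' hii
      obtain ⟨k, hk, hmin⟩ := R.exists_min_image (fun k => (p k).2) (Finset.card_pos.1 (by omega))
      have h1 := hpm k (hRK hk)
      have h2 := hpq k (hRK hk)
      have h3 := hRe k hk
      rw [abs_lt, abs_lt] at h2
      rw [mem_rect] at h1
      have hX : Crossing (G.comap φ) ((p k).1 - (20 * t + 22)) ((p k).1 + (20 * t + 22))
          ((p k).2 - (20 * t + 22)) ((p k).2 + (20 * t + 22)) := by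
        refine GridOn.crossing (Γ₀ := H.comap φ) (s := p k) (r := q k)
          (h.grid.mono (by omega) (by omega) (by omega) (by omega))
          (hD.mono (by omega) (by omega) (by omega) (by omega)) (fun _ _ h => hle h) ?_ ?_
          (hadj k (hRK hk)) (hn k (hRK hk))
        · rw [mem_rect]
          omega
        · rw [mem_rect]
          omega
      obtain ⟨B', hB', hsub, u, hu, v, hv, huv⟩ := hB.extend_crossing hG he (by omega) (by omega)
        (by omega) (by omega) (by omega) hX hii
      refine ⟨R.erase k, (Finset.erase_subset _ _).trans hRK, ?_, _, B', hB', by omega, by omega,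
        ?_, ?_⟩
      · rw [Finset.card_erase_of_mem hk]
        omega
      · intro l hl
        rw [Finset.mem_erase] at hl
        have h4 := hsep l (hRK hl.2) k (hRK hk) hl.1
        have h5 := hmin l hl.2
        rw [abs_of_nonneg (by omega)] at h4
        omega
      · intro j j' hj
        rcases Set.mem_insert_iff.1 hj with hj | hj
        · rcases Sym2.eq_iff.1 hj with ⟨rfl, rfl⟩ | ⟨rfl, rfl⟩
          · exact ⟨u, hu, v, hv, huv⟩
          · exact ⟨v, hv, u, hu, huv.symm⟩
        · obtain ⟨u, hu, v, hv, huv⟩ := hBD j j' hj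
          exact ⟨u, hsub _ hu, v, hsub _ hv, huv⟩)
  exact hB.hasMinor h.inj he fun i j hij => hBD i j (hD i j hij)

/-- The number of short jumps inside a chart that force a `K_t` minor. -/
def shortBound (t : ℕ) : ℕ := (42 * t + 46) ^ 2 * (t ^ 3) ^ 2

lemma Chart.hasMinor_of_short (h : Chart H φ x₀ x₁ y₀ y₁) (hD : DiagOn (H.comap φ) x₀ x₁ y₀ y₁)
    (hle : H ≤ G) (ht : 0 < t) {K : Finset ι} (hK : shortBound t ≤ K.card) {p q : ι → ℤ × ℤ}
    (hp : Set.InjOn p K) (hpm : ∀ k ∈ K, p k ∈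
      rect (x₀ + (30 * t + 30)) (x₁ - (30 * t + 30)) (y₀ + (30 * t + 30)) (y₁ - (30 * t + 30)))
    (hadj : ∀ k ∈ K, G.Adj (φ (p k)) (φ (q k))) (hn : ∀ k ∈ K, ¬ H.Adj (φ (p k)) (φ (q k)))
    (hpq : ∀ k ∈ K, |(p k).1 - (q k).1| < 20 * t + 20 ∧ |(p k).2 - (q k).2| < 20 * t + 20) :
    G.HasMinor (⊤ : SimpleGraph (Fin t)) := by
  obtain ⟨S, hS, hSc, hSs⟩ := exists_spread hp (by omega) hK
  push_cast at hSs
  rcases hSs with hSs | hSs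
  · refine h.swap.hasMinor_of_short_snd hD.swap hle ht hSc (p := Prod.swap ∘ p)
      (q := Prod.swap ∘ q) (fun k hk => ?_) (fun k hk => by simpa using hadj k (hS hk))
      (fun k hk => by simpa using hn k (hS hk)) (fun k hk => (hpq k (hS hk)).symm) hSs
    have := hpm k (hS hk)
    simp only [mem_rect, Function.comp, Prod.fst_swap, Prod.snd_swap] at *
    omega
  · exact h.hasMinor_of_short_snd hD hle ht hSc (fun k hk => hpm k (hS hk))
      (fun k hk => hadj k (hS hk)) (fun k hk => hn k (hS hk)) (fun k hk => hpq k (hS hk)) hSs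

/-- The number of jumps inside a chart that force a `K_t` minor. -/
def chartBound (t : ℕ) : ℕ := 2 * (shortBound t + 4 * longBound t)

lemma Chart.hasMinor (h : Chart H φ x₀ x₁ y₀ y₁) (hD : DiagOn (H.comap φ) x₀ x₁ y₀ y₁)
    (hle : H ≤ G) (ht : 0 < t) {K : Finset ι} (hK : chartBound t ≤ K.card) {p q : ι → ℤ × ℤ}
    (hp : Set.InjOn p K) (hq : Set.InjOn q K)
    (hpm : ∀ k ∈ K, p k ∈
      rect (x₀ + (30 * t + 30)) (x₁ - (30 * t + 30)) (y₀ + (30 * t + 30)) (y₁ - (30 * t + 30)))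
    (hqm : ∀ k ∈ K, q k ∈
      rect (x₀ + (30 * t + 30)) (x₁ - (30 * t + 30)) (y₀ + (30 * t + 30)) (y₁ - (30 * t + 30)))
    (hadj : ∀ k ∈ K, G.Adj (φ (p k)) (φ (q k))) (hn : ∀ k ∈ K, ¬ H.Adj (φ (p k)) (φ (q k))) :
    G.HasMinor (⊤ : SimpleGraph (Fin t)) := by
  rcases exists_half
    (fun k => |(p k).1 - (q k).1| < 20 * t + 20 ∧ |(p k).2 - (q k).2| < 20 * t + 20) hK with ⟨S, hS, hSc, hP⟩ | ⟨S, hS, hSc, hP⟩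
  · exact h.hasMinor_of_short hD hle ht (by omega) (hp.mono hS) (fun k hk => hpm k (hS hk))
      (fun k hk => hadj k (hS hk)) (fun k hk => hn k (hS hk)) hP
  · refine (h.mono_graph hle).hasMinor_of_long ht (by omega) (hp.mono hS) (hq.mono hS) ?_ ?_
      (fun k hk => hadj k (hS hk)) fun k hk => ?_
    · intro k hk
      have := hpm k (hS hk)
      rw [mem_rect] at *
      omega
    · intro k hk
      have := hqm k (hS hk)
      rw [mem_rect] at *
      omega
    · have := hP k hk
      rwa [not_and_or, not_lt, not_lt] at this

end Short

/-! ### Charts of double grids -/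

/-- The part of the structure of a triangulated double grid used to build charts. -/
structure IsDoubleGridLike {ℓ : ℕ} (H : SimpleGraph (Fin 2 × Fin ℓ × Fin ℓ)) : Prop where
  grid : ∀ g p q, gridAdj p q → H.Adj (g, p) (g, q)
  diag : ∀ (g : Fin 2) (x x' y y' : Fin ℓ), x.val + 1 = x'.val → y.val + 1 = y'.val →
    H.Adj (g, x, y) (g, x', y') ∨ H.Adj (g, x', y) (g, x, y')
  matching : ∀ p, onBoundary p → H.Adj (0, p) (1, p)
  matching_diag : ∀ p q, gridAdj p q → onBoundary p → onBoundary q →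
    H.Adj (0, p) (1, q) ∨ H.Adj (0, q) (1, p)

section DoubleGrid

variable {ℓ : ℕ} {H : SimpleGraph (Fin 2 × Fin ℓ × Fin ℓ)}

lemma IsTriangulatedDoubleGrid.isDoubleGridLike (h : IsTriangulatedDoubleGrid H) :
    IsDoubleGridLike H := by
  obtain ⟨G₁, G₂, h₁, h₂, hG₁, hG₂, hm, -, hd⟩ := h
  refine ⟨fun g p q hpq => ?_, fun g x x' y y' hx hy => ?_, fun p hp => (hm p).2 hp,
    fun p q h1 h2 h3 => Xor.or (hd p q h1 h2 h3)⟩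
  · fin_cases g
    · exact (hG₁ p q).2 (h₁.1 p q hpq)
    · exact (hG₂ p q).2 (h₂.1 p q hpq)
  · fin_cases g
    · exact (Xor.or (h₁.2.2 (x, y) (x', y) (x', y') (x, y') hx hy rfl rfl rfl rfl)).imp (hG₁ _ _).2
        (hG₁ _ _).2
    · exact (Xor.or (h₂.2.2 (x, y) (x', y) (x', y') (x, y') hx hy rfl rfl rfl rfl)).imp (hG₂ _ _).2
        (hG₂ _ _).2

/-- Reflection of the grid in the first coordinate. -/
def reflect (ℓ : ℕ) : Equiv.Perm (Fin ℓ × Fin ℓ) := Fin.revPerm.prodCongr (Equiv.refl _)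

/-- The four symmetries of the grid that take the side `x = 0` to the four sides. -/
def sideSymm (ℓ : ℕ) : Fin 4 → Equiv.Perm (Fin ℓ × Fin ℓ) :=
  ![Equiv.refl _, reflect ℓ, Equiv.prodComm _ _,
    ((reflect ℓ).trans (Equiv.prodComm _ _)).trans (reflect ℓ)]

lemma sideSymm_sideSymm (i : Fin 4) (p : Fin ℓ × Fin ℓ) :
    sideSymm ℓ i (sideSymm ℓ i p) = p := by
  obtain ⟨x, y⟩ := p
  fin_cases i <;> simp [sideSymm, reflect]

lemma IsDoubleGridLike.reflect (h : IsDoubleGridLike H) :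
    IsDoubleGridLike (H.comap (Prod.map id (reflect ℓ))) := by
  have hg : ∀ p q, gridAdj p q → gridAdj (_root_.reflect ℓ p) (_root_.reflect ℓ q) := by
    rintro ⟨x, y⟩ ⟨x', y'⟩
    simp only [gridAdj, _root_.reflect, Equiv.prodCongr_apply, Prod.map_apply, Fin.revPerm_apply,
      Fin.val_rev, Fin.ext_iff, Equiv.refl_apply]
    omega
  have hb : ∀ p, onBoundary p → onBoundary (_root_.reflect ℓ p) := by
    rintro ⟨x, y⟩
    simp only [onBoundary, _root_.reflect, Equiv.prodCongr_apply, Prod.map_apply,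
      Fin.revPerm_apply, Fin.val_rev, Equiv.refl_apply]
    omega
  refine ⟨fun g p q hpq => h.grid _ _ _ (hg p q hpq), fun g x x' y y' hx hy => ?_,
    fun p hp => h.matching _ (hb p hp),
    fun p q hpq hp hq => h.matching_diag _ _ (hg p q hpq) (hb p hp) (hb q hq)⟩
  have := h.diag g x'.rev x.rev y y' (by simp only [Fin.val_rev]; omega) hy
  exact this.symm

lemma IsDoubleGridLike.prodComm (h : IsDoubleGridLike H) :
    IsDoubleGridLike (H.comap (Prod.map id (Equiv.prodComm _ _))) := by
  have hg : ∀ p q : Fin ℓ × Fin ℓ, gridAdj p q → gridAdj p.swap q.swap := fun p q hpq => hpq.symm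
  have hb : ∀ p : Fin ℓ × Fin ℓ, onBoundary p → onBoundary p.swap := by
    rintro ⟨x, y⟩
    simp only [onBoundary, Prod.swap_prod_mk]
    omega
  refine ⟨fun g p q hpq => h.grid _ _ _ (hg p q hpq), fun g x x' y y' hx hy => ?_,
    fun p hp => h.matching _ (hb p hp),
    fun p q hpq hp hq => h.matching_diag _ _ (hg p q hpq) (hb p hp) (hb q hq)⟩
  exact (h.diag g y y' x x' hy hx).imp id fun h' => h'.symm

lemma IsDoubleGridLike.sideSymm (h : IsDoubleGridLike H) (i : Fin 4) :
    IsDoubleGridLike (H.comap (Prod.map id (sideSymm ℓ i))) := by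
  fin_cases i
  · exact h
  · exact h.reflect
  · exact h.prodComm
  · exact h.reflect.prodComm.reflect

/-- The plane coordinates of the double grid cut open along all sides but `x = 0`. -/
def coord (z : Fin 2 × Fin ℓ × Fin ℓ) : ℤ × ℤ :=
  (if z.1 = 0 then (z.2.1.val : ℤ) else -1 - z.2.1.val, z.2.2.val)

/-- The inverse of `coord` on the rectangle `[-ℓ, ℓ - 1] × [0, ℓ - 1]`. -/
def unfold [NeZero ℓ] (p : ℤ × ℤ) : Fin 2 × Fin ℓ × Fin ℓ :=
  if 0 ≤ p.1 then (0, Fin.ofNat ℓ p.1.toNat, Fin.ofNat ℓ p.2.toNat)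
  else (1, Fin.ofNat ℓ (-1 - p.1).toNat, Fin.ofNat ℓ p.2.toNat)

variable [NeZero ℓ]

lemma ofNat_toNat_val {u : ℤ} (h : 0 ≤ u) (h' : u ≤ ℓ - 1) :
    ((Fin.ofNat ℓ u.toNat).val : ℤ) = u := by
  rw [Fin.val_ofNat, Nat.mod_eq_of_lt (by omega)]
  omega

lemma coord_unfold {p : ℤ × ℤ} (hp : p ∈ rect (-ℓ) (ℓ - 1) 0 (ℓ - 1)) :
    coord (unfold (ℓ := ℓ) p) = p := by
  rw [mem_rect] at hp
  unfold unfold coord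
  split_ifs with h1 h2 h2
  · exact Prod.ext (ofNat_toNat_val h1 hp.2.1) (ofNat_toNat_val hp.2.2.1 hp.2.2.2)
  · simp at h2
  · simp at h2
  · refine Prod.ext ?_ (ofNat_toNat_val hp.2.2.1 hp.2.2.2)
    simp only
    rw [ofNat_toNat_val (by omega) (by omega)]
    omega

lemma unfold_coord (z : Fin 2 × Fin ℓ × Fin ℓ) : unfold (coord z) = z := by
  obtain ⟨g, x, y⟩ := z
  unfold unfold coord
  fin_cases g
  · simp
  · rw [if_neg]
    · simp
    · simp only [Fin.mk_one, one_ne_zero, if_false]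
      omega

lemma unfold_of_nonneg {u v : ℤ} {a b : Fin ℓ} (ha : (a.val : ℤ) = u) (hb : (b.val : ℤ) = v) :
    unfold (u, v) = (0, a, b) := by
  rw [← unfold_coord (0, a, b), ← ha, ← hb]
  rfl

lemma unfold_of_neg {u v : ℤ} {a b : Fin ℓ} (ha : -1 - (a.val : ℤ) = u) (hb : (b.val : ℤ) = v) :
    unfold (u, v) = (1, a, b) := by
  rw [← unfold_coord (1, a, b), ← ha, ← hb]
  rfl

lemma exists_fin_eq {u : ℤ} (h : 0 ≤ u) (h' : u ≤ ℓ - 1) : ∃ a : Fin ℓ, (a.val : ℤ) = u :=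
  ⟨_, ofNat_toNat_val h h'⟩

lemma IsDoubleGridLike.gridOn_unfold (h : IsDoubleGridLike H) :
    GridOn (H.comap unfold) (-ℓ) (ℓ - 1) 0 (ℓ - 1) := by
  refine ⟨fun x y h1 h2 h3 h4 => ?_, fun x y h1 h2 h3 h4 => ?_⟩ <;> rw [comap_adj]
  · obtain ⟨b, hb⟩ := exists_fin_eq (ℓ := ℓ) h3 (by omega)
    obtain ⟨b', hb'⟩ := exists_fin_eq (ℓ := ℓ) (u := y + 1) (by omega) h4
    rcases le_or_gt 0 x with hx | hx
    · obtain ⟨a, ha⟩ := exists_fin_eq hx h2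
      rw [unfold_of_nonneg ha hb, unfold_of_nonneg ha hb']
      exact h.grid 0 _ _ (Or.inl ⟨rfl, by simp only; omega⟩)
    · obtain ⟨a, ha⟩ := exists_fin_eq (ℓ := ℓ) (u := -1 - x) (by omega) (by omega)
      rw [unfold_of_neg (a := a) (by omega) hb, unfold_of_neg (a := a) (by omega) hb']
      exact h.grid 1 _ _ (Or.inl ⟨rfl, by simp only; omega⟩)
  · obtain ⟨b, hb⟩ := exists_fin_eq h3 h4
    rcases le_or_gt 0 x with hx | hx
    · obtain ⟨a, ha⟩ := exists_fin_eq (ℓ := ℓ) hx (by omega)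
      obtain ⟨a', ha'⟩ := exists_fin_eq (ℓ := ℓ) (u := x + 1) (by omega) h2
      rw [unfold_of_nonneg ha hb, unfold_of_nonneg ha' hb]
      exact h.grid 0 _ _ (Or.inr ⟨rfl, by simp only; omega⟩)
    · obtain ⟨a, ha⟩ := exists_fin_eq (ℓ := ℓ) (u := -1 - x) (by omega) (by omega)
      rw [unfold_of_neg (a := a) (by omega) hb]
      rcases eq_or_ne x (-1) with rfl | hx'
      · rw [unfold_of_nonneg (a := a) (by omega) hb]
        exact (h.matching _ (Or.inl (by simp only; omega))).symm
      · obtain ⟨a', ha'⟩ := exists_fin_eq (ℓ := ℓ) (u := -1 - (x + 1)) (by omega) (by omega)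
        rw [unfold_of_neg (a := a') (by omega) hb]
        exact h.grid 1 _ _ (Or.inr ⟨rfl, by simp only; omega⟩)

lemma IsDoubleGridLike.diagOn_unfold (h : IsDoubleGridLike H) :
    DiagOn (H.comap unfold) (-ℓ) (ℓ - 1) 0 (ℓ - 1) := by
  intro x y h1 h2 h3 h4
  rw [comap_adj, comap_adj]
  obtain ⟨b, hb⟩ := exists_fin_eq (ℓ := ℓ) h3 (by omega)
  obtain ⟨b', hb'⟩ := exists_fin_eq (ℓ := ℓ) (u := y + 1) (by omega) h4
  rcases le_or_gt 0 x with hx | hx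
  · obtain ⟨a, ha⟩ := exists_fin_eq (ℓ := ℓ) hx (by omega)
    obtain ⟨a', ha'⟩ := exists_fin_eq (ℓ := ℓ) (u := x + 1) (by omega) h2
    rw [unfold_of_nonneg ha hb, unfold_of_nonneg ha' hb', unfold_of_nonneg ha' hb,
      unfold_of_nonneg ha hb']
    exact h.diag 0 _ _ _ _ (by omega) (by omega)
  · obtain ⟨a, ha⟩ := exists_fin_eq (ℓ := ℓ) (u := -1 - x) (by omega) (by omega)
    rw [unfold_of_neg (u := x) (a := a) (by omega) hb,
      unfold_of_neg (u := x) (a := a) (by omega) hb']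
    rcases eq_or_ne x (-1) with rfl | hx'
    · rw [unfold_of_nonneg (u := -1 + 1) (a := a) (by omega) hb,
        unfold_of_nonneg (u := -1 + 1) (a := a) (by omega) hb']
      exact (h.matching_diag (a, b) (a, b') (Or.inl ⟨rfl, by simp only; omega⟩)
        (Or.inl (by simp only; omega)) (Or.inl (by simp only; omega))).symm.imp
        SimpleGraph.Adj.symm id
    · obtain ⟨a', ha'⟩ := exists_fin_eq (ℓ := ℓ) (u := -1 - (x + 1)) (by omega) (by omega)
      rw [unfold_of_neg (u := x + 1) (a := a') (by omega) hb,
        unfold_of_neg (u := x + 1) (a := a') (by omega) hb']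
      exact (h.diag 1 a' a b b' (by omega) (by omega)).symm

/-- The chart of the double grid around the side `i`. -/
def sideChart (ℓ : ℕ) [NeZero ℓ] (i : Fin 4) (p : ℤ × ℤ) : Fin 2 × Fin ℓ × Fin ℓ :=
  Prod.map id (sideSymm ℓ i) (unfold p)

/-- The coordinates in the chart around the side `i`. -/
def sideCoord (i : Fin 4) (z : Fin 2 × Fin ℓ × Fin ℓ) : ℤ × ℤ :=
  coord (Prod.map id (sideSymm ℓ i) z)

lemma sideChart_sideCoord (i : Fin 4) (z : Fin 2 × Fin ℓ × Fin ℓ) :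
    sideChart ℓ i (sideCoord i z) = z := by
  unfold sideChart sideCoord
  rw [unfold_coord]
  exact Prod.ext rfl (sideSymm_sideSymm i z.2)

lemma sideCoord_sideChart (i : Fin 4) {p : ℤ × ℤ} (hp : p ∈ rect (-ℓ) (ℓ - 1) 0 (ℓ - 1)) :
    sideCoord i (sideChart ℓ i p) = p := by
  have : Prod.map id (sideSymm ℓ i) (Prod.map id (sideSymm ℓ i) (unfold p)) = unfold p :=
    Prod.ext rfl (sideSymm_sideSymm i _)
  unfold sideChart sideCoord
  rw [this, coord_unfold hp]

lemma sideCoord_injective (i : Fin 4) : Function.Injective (sideCoord (ℓ := ℓ) i) :=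
  Function.LeftInverse.injective (sideChart_sideCoord i)

lemma IsDoubleGridLike.chart (h : IsDoubleGridLike H) (i : Fin 4) :
    Chart H (sideChart ℓ i) (-ℓ) (ℓ - 1) 0 (ℓ - 1) :=
  ⟨fun p hp q hq hpq => by rw [← sideCoord_sideChart i hp, hpq, sideCoord_sideChart i hq],
    (h.sideSymm i).gridOn_unfold⟩

lemma IsDoubleGridLike.diagOn (h : IsDoubleGridLike H) (i : Fin 4) :
    DiagOn (H.comap (sideChart ℓ i)) (-ℓ) (ℓ - 1) 0 (ℓ - 1) :=
  (h.sideSymm i).diagOn_unfold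

/-- The vertices in the `i`-th chart that are at distance at least `d` from its boundary. -/
def deepPart (ℓ d : ℕ) (i : Fin 4) : Set (Fin 2 × Fin ℓ × Fin ℓ) :=
  {z | sideCoord i z ∈ rect (-ℓ + d) (ℓ - 1 - d) d (ℓ - 1 - d)}

/-- The vertices close to the side `i` and far from the corners. -/
def sidePart (ℓ d : ℕ) (i : Fin 4) : Set (Fin 2 × Fin ℓ × Fin ℓ) :=
  {z | sideCoord i z ∈ rect (-d) (d - 1) (3 * d) (ℓ - 1 - 3 * d)}

/-- The vertices close to a corner. -/
def cornerPart (ℓ d : ℕ) : Finset (Fin 2 × Fin ℓ × Fin ℓ) :=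
  Finset.univ ×ˢ ((Finset.univ.filter fun x : Fin ℓ => x.val < 3 * d ∨ ℓ ≤ x.val + 3 * d) ×ˢ
    Finset.univ.filter fun x : Fin ℓ => x.val < 3 * d ∨ ℓ ≤ x.val + 3 * d)

lemma card_cornerPart (d : ℕ) : (cornerPart ℓ d).card ≤ 72 * d ^ 2 := by
  classical
  have : (Finset.univ.filter fun x : Fin ℓ => x.val < 3 * d ∨ ℓ ≤ x.val + 3 * d).card ≤ 6 * d := by
    have hsub : (Finset.univ.filter fun x : Fin ℓ => x.val < 3 * d ∨ ℓ ≤ x.val + 3 * d) ⊆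
        (Finset.range (3 * d)).image (fun a => Fin.ofNat ℓ a) ∪
          (Finset.range (3 * d)).image fun a => (Fin.ofNat ℓ a).rev := by
      intro x hx
      have hx' := x.isLt
      simp only [Finset.mem_filter, Finset.mem_univ, true_and] at hx
      simp only [Finset.mem_union, Finset.mem_image, Finset.mem_range]
      rcases hx with hx | hx
      · exact Or.inl ⟨x.val, hx, by simp⟩
      · exact Or.inr ⟨x.rev.val, by rw [Fin.val_rev]; omega, by simp [-Fin.val_rev]⟩
    refine (Finset.card_le_card hsub).trans ((Finset.card_union_le _ _).trans ?_)
    have h1 := Finset.card_image_le (s := Finset.range (3 * d)) (f := fun a => Fin.ofNat ℓ a)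
    have h2 := Finset.card_image_le (s := Finset.range (3 * d)) (f := fun a => (Fin.ofNat ℓ a).rev)
    rw [Finset.card_range] at h1 h2
    omega
  unfold cornerPart
  rw [Finset.card_product, Finset.card_product, Finset.card_univ, Fintype.card_fin]
  nlinarith [Nat.mul_le_mul this this]

omit [NeZero ℓ] in
lemma sideCoord_zero (z : Fin 2 × Fin ℓ × Fin ℓ) :
    sideCoord 0 z = (if z.1 = 0 then (z.2.1.val : ℤ) else -1 - z.2.1.val, (z.2.2.val : ℤ)) :=
  rfl

omit [NeZero ℓ] in
lemma sideCoord_one (z : Fin 2 × Fin ℓ × Fin ℓ) :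
    sideCoord 1 z =
      (if z.1 = 0 then (z.2.1.rev.val : ℤ) else -1 - z.2.1.rev.val, (z.2.2.val : ℤ)) :=
  rfl

omit [NeZero ℓ] in
lemma sideCoord_two (z : Fin 2 × Fin ℓ × Fin ℓ) :
    sideCoord 2 z = (if z.1 = 0 then (z.2.2.val : ℤ) else -1 - z.2.2.val, (z.2.1.val : ℤ)) :=
  rfl

omit [NeZero ℓ] in
lemma sideCoord_three (z : Fin 2 × Fin ℓ × Fin ℓ) :
    sideCoord 3 z =
      (if z.1 = 0 then (z.2.2.rev.val : ℤ) else -1 - z.2.2.rev.val, (z.2.1.rev.val : ℤ)) :=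
  rfl

omit [NeZero ℓ] in
lemma sidePart_subset_deepPart {d : ℕ} (hd : 2 * d ≤ ℓ) (i : Fin 4) :
    sidePart ℓ d i ⊆ deepPart ℓ d i := by
  intro z hz
  simp only [sidePart, deepPart, Set.mem_ofPred_eq, mem_rect] at hz ⊢
  omega

omit [NeZero ℓ] in
lemma mem_deepPart_or_mem_sidePart {d : ℕ} {z : Fin 2 × Fin ℓ × Fin ℓ}
    (hz : z ∉ cornerPart ℓ d) : (∀ i, z ∈ deepPart ℓ d i) ∨ ∃ i, z ∈ sidePart ℓ d i := by
  obtain ⟨g, x, y⟩ := z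
  have hx := x.isLt
  have hy := y.isLt
  simp only [cornerPart, Finset.mem_product, Finset.mem_univ, Finset.mem_filter, true_and] at hz
  simp only [deepPart, sidePart, Set.mem_ofPred_eq, Fin.forall_fin_succ, Fin.exists_fin_succ,
    mem_rect]
  simp only [Fin.succ_zero_eq_one, Fin.succ_one_eq_two, Fin.reduceSucc, IsEmpty.forall_iff,
    IsEmpty.exists_iff, and_true, or_false, sideCoord_zero, sideCoord_one, sideCoord_two,
    sideCoord_three, Fin.val_rev]
  have h : (x.val < d ∨ ℓ ≤ x.val + d ∨ y.val < d ∨ ℓ ≤ y.val + d) ∨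
      (d ≤ x.val ∧ x.val + d < ℓ ∧ d ≤ y.val ∧ y.val + d < ℓ) := by omega
  rcases h with h | h
  · refine Or.inr ?_
    rcases h with h | h | h | h
    · refine Or.inl ?_
      split_ifs <;> omega
    · refine Or.inr (Or.inl ?_)
      split_ifs <;> omega
    · refine Or.inr (Or.inr (Or.inl ?_))
      split_ifs <;> omega
    · refine Or.inr (Or.inr (Or.inr ?_))
      split_ifs <;> omega
  · refine Or.inl ?_
    split_ifs <;> omega

omit [NeZero ℓ] in
lemma eq_of_mem_collar {d : ℕ} {z : Fin 2 × Fin ℓ × Fin ℓ} {i j : Fin 4}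
    (hi : sideCoord i z ∈ rect (-(2 * d)) (2 * d - 1) (2 * d) (ℓ - 1 - 2 * d))
    (hj : sideCoord j z ∈ rect (-(2 * d)) (2 * d - 1) (2 * d) (ℓ - 1 - 2 * d)) : i = j := by
  obtain ⟨g, x, y⟩ := z
  have hx := x.isLt
  have hy := y.isLt
  rw [mem_rect] at hi hj
  revert hi hj
  fin_cases i <;> fin_cases j <;>
    simp only [Fin.zero_eta, Fin.mk_one, Fin.reduceFinMk, sideCoord_zero, sideCoord_one,
      sideCoord_two, sideCoord_three, Fin.val_rev, implies_true] <;>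
    split_ifs <;> omega

variable {G : SimpleGraph (Fin 2 × Fin ℓ × Fin ℓ)} {t : ℕ} {ι : Type*} {K : Finset ι}
  {r s : ι → Fin 2 × Fin ℓ × Fin ℓ}

lemma IsDoubleGridLike.hasMinor_of_deep (h : IsDoubleGridLike H) (hle : H ≤ G) (ht : 0 < t)
    (hK : chartBound t ≤ K.card) (hr : Set.InjOn r K) (hs : Set.InjOn s K)
    (hadj : ∀ k ∈ K, G.Adj (r k) (s k)) (hn : ∀ k ∈ K, ¬ H.Adj (r k) (s k)) {i : Fin 4}
    (hi : ∀ k ∈ K, r k ∈ deepPart ℓ (30 * t + 30) i ∧ s k ∈ deepPart ℓ (30 * t + 30) i) :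
    G.HasMinor (⊤ : SimpleGraph (Fin t)) := by
  refine (h.chart i).hasMinor (h.diagOn i) hle ht hK (p := sideCoord i ∘ r) (q := sideCoord i ∘ s)
    ((sideCoord_injective i).comp_injOn hr) ((sideCoord_injective i).comp_injOn hs)
    (fun k hk => ?_) (fun k hk => ?_) (fun k hk => ?_) (fun k hk => ?_)
  · have := (hi k hk).1
    simp only [deepPart, Set.mem_ofPred_eq, mem_rect, Function.comp] at this ⊢
    omega
  · have := (hi k hk).2
    simp only [deepPart, Set.mem_ofPred_eq, mem_rect, Function.comp] at this ⊢
    omega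
  · simpa only [Function.comp, sideChart_sideCoord] using hadj k hk
  · simpa only [Function.comp, sideChart_sideCoord] using hn k hk

lemma disjoint_sideChart {d : ℕ} (hd : 2 * d ≤ ℓ) {i j : Fin 4} (hij : i ≠ j) :
    Disjoint (sideChart ℓ i '' rect (-(2 * d)) (2 * d - 1) (2 * d) (ℓ - 1 - 2 * d))
      (sideChart ℓ j '' rect (-(2 * d)) (2 * d - 1) (2 * d) (ℓ - 1 - 2 * d)) := by
  have hsub : ∀ p ∈ rect (-(2 * d)) (2 * d - 1) (2 * d) (ℓ - 1 - 2 * d),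
      p ∈ rect (-ℓ) (ℓ - 1) 0 (ℓ - 1) := by
    intro p hp
    rw [mem_rect] at hp ⊢
    omega
  rw [Set.disjoint_left]
  rintro _ ⟨p, hp, rfl⟩ ⟨q, hq, hpq⟩
  refine hij (eq_of_mem_collar (d := d) (z := sideChart ℓ i p) ?_ ?_)
  · rwa [sideCoord_sideChart i (hsub p hp)]
  · rwa [← hpq, sideCoord_sideChart j (hsub q hq)]

lemma IsDoubleGridLike.hasMinor_of_side (h : IsDoubleGridLike H) (hle : H ≤ G) (ht : 0 < t)
    (hℓ : 2 * (30 * t + 30) ≤ ℓ) (hK : crossBound t ≤ K.card) (hr : Set.InjOn r K)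
    (hs : Set.InjOn s K) (hadj : ∀ k ∈ K, G.Adj (r k) (s k)) {i j : Fin 4} (hij : i ≠ j)
    (hK' : ∀ k ∈ K, r k ∈ sidePart ℓ (30 * t + 30) i ∧ s k ∈ sidePart ℓ (30 * t + 30) j) :
    G.HasMinor (⊤ : SimpleGraph (Fin t)) := by
  have hchart : ∀ i, Chart G (sideChart ℓ i) (-(2 * (30 * t + 30 : ℕ))) (2 * (30 * t + 30 : ℕ) - 1)
      (2 * (30 * t + 30 : ℕ)) (ℓ - 1 - 2 * (30 * t + 30 : ℕ)) := fun i =>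
    ((h.chart i).mono_graph hle).mono (by omega) (by omega) (by omega) (by omega)
  refine hasMinor_of_cross ht (hchart i) (hchart j) (disjoint_sideChart hℓ hij) hK
    (p := sideCoord i ∘ r) (q := sideCoord j ∘ s)
    ((sideCoord_injective i).comp_injOn hr) ((sideCoord_injective j).comp_injOn hs)
    (fun k hk => ?_) (fun k hk => ?_) (fun k hk => ?_)
  · have := (hK' k hk).1
    simp only [sidePart, Set.mem_ofPred_eq, mem_rect, Function.comp] at this ⊢
    omega
  · have := (hK' k hk).2
    simp only [sidePart, Set.mem_ofPred_eq, mem_rect, Function.comp] at this ⊢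
    omega
  · simpa only [Function.comp, sideChart_sideCoord] using hadj k hk

omit [NeZero ℓ] in
lemma exists_common_part {d : ℕ} (hd : 2 * d ≤ ℓ) {z z' : Fin 2 × Fin ℓ × Fin ℓ}
    (hz : z ∉ cornerPart ℓ d) (hz' : z' ∉ cornerPart ℓ d) :
    ∃ x : Fin 4 × Fin 4, (x.1 = x.2 ∧ z ∈ deepPart ℓ d x.1 ∧ z' ∈ deepPart ℓ d x.1) ∨
      (x.1 ≠ x.2 ∧ z ∈ sidePart ℓ d x.1 ∧ z' ∈ sidePart ℓ d x.2) := by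
  rcases mem_deepPart_or_mem_sidePart hz with h | ⟨i, hi⟩ <;>
    rcases mem_deepPart_or_mem_sidePart hz' with h' | ⟨j, hj⟩
  · exact ⟨(0, 0), Or.inl ⟨rfl, h 0, h' 0⟩⟩
  · exact ⟨(j, j), Or.inl ⟨rfl, h j, sidePart_subset_deepPart hd j hj⟩⟩
  · exact ⟨(i, i), Or.inl ⟨rfl, sidePart_subset_deepPart hd i hi, h' i⟩⟩
  · rcases eq_or_ne i j with rfl | hij
    · exact ⟨(i, i), Or.inl ⟨rfl, sidePart_subset_deepPart hd i hi,
        sidePart_subset_deepPart hd i hj⟩⟩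
    · exact ⟨(i, j), Or.inr ⟨hij, hi, hj⟩⟩

/-- The number of jumps in a triangulated double grid that force a `K_t` minor. -/
def jumpBound (t : ℕ) : ℕ := 16 * (chartBound t + crossBound t) + 144 * (30 * t + 30) ^ 2

lemma IsDoubleGridLike.hasMinor (h : IsDoubleGridLike H) (hle : H ≤ G) (ht : 0 < t)
    (hℓ : 2 * (30 * t + 30) ≤ ℓ) (hK : jumpBound t ≤ K.card) (hr : Set.InjOn r K)
    (hs : Set.InjOn s K) (hadj : ∀ k ∈ K, G.Adj (r k) (s k))
    (hn : ∀ k ∈ K, ¬ H.Adj (r k) (s k)) : G.HasMinor (⊤ : SimpleGraph (Fin t)) := by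
  classical
  set d := 30 * t + 30 with hd
  have hcorner : ∀ r : ι → Fin 2 × Fin ℓ × Fin ℓ, Set.InjOn r K →
      (K.filter fun k => r k ∈ cornerPart ℓ d).card ≤ 72 * d ^ 2 := fun r hr =>
    (Finset.card_le_card_of_injOn r (fun k hk => (Finset.mem_filter.1 hk).2)
      (hr.mono fun k hk => (Finset.mem_filter.1 hk).1)).trans (card_cornerPart d)
  set L := K.filter fun k => r k ∉ cornerPart ℓ d ∧ s k ∉ cornerPart ℓ d with hL
  have hcover : K ⊆ L ∪ ((K.filter fun k => r k ∈ cornerPart ℓ d) ∪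
      K.filter fun k => s k ∈ cornerPart ℓ d) := by
    intro k hk
    simp only [hL, Finset.mem_union, Finset.mem_filter, hk, true_and]
    tauto
  have hLc : 16 * (chartBound t + crossBound t) ≤ L.card := by
    have h1 := (Finset.card_le_card hcover).trans ((Finset.card_union_le _ _).trans
      (Nat.add_le_add_left (Finset.card_union_le _ _) _))
    have h2 := hcorner r hr
    have h3 := hcorner s hs
    rw [jumpBound, ← hd] at hK
    omega
  have hpart : ∀ k ∈ L, _ := fun k hk =>
    exists_common_part hℓ (Finset.mem_filter.1 hk).2.1 (Finset.mem_filter.1 hk).2.2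
  choose! c hc using hpart
  obtain ⟨x, -, hx⟩ := Finset.exists_le_card_fiber_of_mul_le_card_of_maps_to
    (f := c) (t := Finset.univ) (n := chartBound t + crossBound t) (s := L)
    (fun _ _ => Finset.mem_univ _) Finset.univ_nonempty
    (by simpa [Finset.card_univ, Fintype.card_prod, Fintype.card_fin] using hLc)
  set S := L.filter fun k => c k = x with hS
  have hSL : ∀ k ∈ S, k ∈ L ∧ c k = x := fun k hk => Finset.mem_filter.1 hk
  have hSK : S ⊆ K := (Finset.filter_subset _ _).trans (Finset.filter_subset _ _)
  have hSx : ∀ k ∈ S, _ := fun k hk => (hSL k hk).2 ▸ hc k (hSL k hk).1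
  rcases eq_or_ne x.1 x.2 with hx' | hx'
  · exact h.hasMinor_of_deep hle ht (by omega) (hr.mono hSK) (hs.mono hSK)
      (fun k hk => hadj k (hSK hk)) (fun k hk => hn k (hSK hk)) (i := x.1)
      fun k hk => ((hSx k hk).resolve_right fun h => h.1 hx').2
  · exact h.hasMinor_of_side hle ht hℓ (by omega) (hr.mono hSK) (hs.mono hSK)
      (fun k hk => hadj k (hSK hk)) hx'
      fun k hk => ((hSx k hk).resolve_left fun h => hx' h.1).2

end DoubleGrid

/-! ### The bound is polynomial -/

/-- A function bounded above by a polynomial. -/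
def PolyBounded (f : ℕ → ℕ) : Prop := ∃ C c : ℕ, ∀ t, f t ≤ C * (t + 1) ^ c

namespace PolyBounded

variable {f g : ℕ → ℕ}

lemma const (a : ℕ) : PolyBounded fun _ => a := ⟨a, 0, fun t => by simp⟩

lemma id : PolyBounded fun t => t := ⟨1, 1, fun t => by simp⟩

lemma add (hf : PolyBounded f) (hg : PolyBounded g) : PolyBounded fun t => f t + g t := by
  obtain ⟨C, c, hC⟩ := hf
  obtain ⟨D, e, hD⟩ := hg
  refine ⟨C + D, max c e, fun t => ?_⟩
  rw [add_mul]
  refine Nat.add_le_add ?_ ?_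
  · exact (hC t).trans (Nat.mul_le_mul_left _ (Nat.pow_le_pow_right (by omega) (le_max_left _ _)))
  · exact (hD t).trans (Nat.mul_le_mul_left _ (Nat.pow_le_pow_right (by omega) (le_max_right _ _)))

lemma mul (hf : PolyBounded f) (hg : PolyBounded g) : PolyBounded fun t => f t * g t := by
  obtain ⟨C, c, hC⟩ := hf
  obtain ⟨D, e, hD⟩ := hg
  refine ⟨C * D, c + e, fun t => (Nat.mul_le_mul (hC t) (hD t)).trans_eq ?_⟩
  ring

lemma pow (hf : PolyBounded f) (n : ℕ) : PolyBounded fun t => f t ^ n := by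
  induction n with
  | zero => simpa using const 1
  | succ n ih => simpa only [pow_succ] using ih.mul hf

end PolyBounded

lemma polyBounded_jumpBound : PolyBounded jumpBound := by
  have hlin (a b : ℕ) : PolyBounded fun t => a * t + b :=
    ((PolyBounded.const a).mul .id).add (.const b)
  have hcross : PolyBounded crossBound :=
    ((hlin 2 2).pow 2).mul ((((hlin 2 2).pow 2).mul ((PolyBounded.id.pow 2).pow 2)).pow 2)
  have hlong : PolyBounded longBound :=
    (((PolyBounded.const 2).mul hcross).add (.const 1)).mul (.pow .id 2)
  have hshort : PolyBounded shortBound := ((hlin 42 46).pow 2).mul ((PolyBounded.id.pow 3).pow 2)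
  have hchart : PolyBounded chartBound :=
    (PolyBounded.const 2).mul (hshort.add ((PolyBounded.const 4).mul hlong))
  exact ((PolyBounded.const 16).mul (hchart.add hcross)).add
    ((PolyBounded.const 144).mul ((hlin 30 30).pow 2))

/-- There is a polynomially bounded function `f : ℕ → ℕ` such that for
every `t ≥ 1` and `ℓ ≥ 2 f t`, if `H` is a triangulated `ℓ × ℓ` double grid and `M` is a
set of pairwise disjoint jumps of `H` with `|M| ≥ f t`, then `K_t` is a minor of `H ∪ M`. -/
theorem statement2 :
    ∃ f : ℕ → ℕ,
      (∃ C c : ℕ, ∀ t, f t ≤ C * (t + 1) ^ c) ∧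
      ∀ t ℓ : ℕ, 0 < t → 2 * f t ≤ ℓ →
        ∀ H : SimpleGraph (Fin 2 × Fin ℓ × Fin ℓ),
          IsTriangulatedDoubleGrid H →
          ∀ M : Set (Sym2 (Fin 2 × Fin ℓ × Fin ℓ)),
            (∀ e ∈ M, ¬ e.IsDiag ∧ e ∉ H.edgeSet) →
            (M.Pairwise fun e e' => ∀ v, v ∈ e → v ∉ e') →
            f t ≤ M.ncard →
            (SimpleGraph.fromEdgeSet (H.edgeSet ∪ M)).HasMinor (⊤ : SimpleGraph (Fin t)) := by
  refine ⟨jumpBound, polyBounded_jumpBound, fun t ℓ ht hℓ H hH M hM hdisj hcard => ?_⟩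
  classical
  have hd : 30 * t + 30 ≤ jumpBound t := by
    unfold jumpBound
    nlinarith [Nat.zero_le (chartBound t + crossBound t)]
  have : NeZero ℓ := ⟨by omega⟩
  rw [Set.ncard_eq_toFinset_card'] at hcard
  have hrep : ∀ e : Sym2 (Fin 2 × Fin ℓ × Fin ℓ), ∃ u v, s(u, v) = e :=
    fun e => e.ind fun u v => ⟨u, v, rfl⟩
  choose r r' hr using hrep
  have hinj (v : Sym2 (Fin 2 × Fin ℓ × Fin ℓ) → Fin 2 × Fin ℓ × Fin ℓ) (hv : ∀ e, v e ∈ e) :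
      Set.InjOn v M.toFinset := fun e he e' he' hee' => by_contra fun hne =>
    hdisj (Set.mem_toFinset.1 he) (Set.mem_toFinset.1 he') hne (v e) (hv e) (hee' ▸ hv e')
  refine hH.isDoubleGridLike.hasMinor (fun u v huv => ?_) ht (by omega) hcard
    (hinj r fun e => Sym2.mem_iff_exists.2 ⟨r' e, (hr e).symm⟩)
    (hinj r' fun e => Sym2.mem_iff_exists.2 ⟨r e, Sym2.eq_swap.trans (hr e) |>.symm⟩)
    (fun e he => ?_) (fun e he => ?_)
  · exact (fromEdgeSet_adj _).2 ⟨Or.inl huv, huv.ne⟩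
  · have he := Set.mem_toFinset.1 he
    refine (fromEdgeSet_adj _).2 ⟨Or.inr (by rwa [hr]), fun h => (hM e he).1 ?_⟩
    rw [← hr e]
    exact h
  · have := (hM e (Set.mem_toFinset.1 he)).2
    rwa [← hr e, mem_edgeSet] at this
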